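/- arXiv:1211.6138 — 13 statements merged into one kernel-verified Lean document; each statement's English description precedes it below -/
import Mathlib

section
/- Let u_0 = (1, 0), u_1 = (cos(2π/3), sin(2π/3)), u_2 = (cos(4π/3), sin(4π/3)) be the three unit vectors at angles 0, 2π/3, 4π/3. Then for every point x ∈ ℝ² there exists an index j ∈ {0, 1, 2} such that ‖⟨u_j, x⟩‖ ≤ 1/3. In other words, the three rotations of the strip set E_{1/3} by angles 0, 2π/3, 4π/3 cover the plane. -/
/-- Distance from a real number to the nearest integer. -/
noncomputable def intDist (t : ℝ) : ℝ := |t - round t|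

/-- Standard inner product on ℝ². -/
def dot2 (u x : ℝ × ℝ) : ℝ := u.1 * x.1 + u.2 * x.2

theorem floor_bounds_of_lt_intDist {ε t : ℝ} (h : ε < intDist t) :
    ⌊t⌋ + ε < t ∧ t < ⌊t⌋ + 1 - ε := by
  have hfloor := h.trans_le (round_le t ⌊t⌋)
  have hsucc := h.trans_le (round_le t (⌊t⌋ + 1))
  rw [abs_of_nonneg (sub_nonneg.2 (Int.floor_le t))] at hfloor
  push_cast at hsucc
  rw [abs_of_neg (sub_neg.2 (Int.lt_floor_add_one t))] at hsucc
  constructor <;> linarith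

/-- Among three reals with sum zero, one is within `1 / 3` of an integer. -/
theorem exists_intDist_le_of_sum_eq_zero {a b c : ℝ} (h : a + b + c = 0) :
    intDist a ≤ 1 / 3 ∨ intDist b ≤ 1 / 3 ∨ intDist c ≤ 1 / 3 := by
  by_contra! hlt
  obtain ⟨ha, ha'⟩ := floor_bounds_of_lt_intDist hlt.1
  obtain ⟨hb, hb'⟩ := floor_bounds_of_lt_intDist hlt.2.1
  obtain ⟨hc, hc'⟩ := floor_bounds_of_lt_intDist hlt.2.2
  have hupper : ((⌊a⌋ + ⌊b⌋ + ⌊c⌋ : ℤ) : ℝ) < ((-1 : ℤ) : ℝ) := by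
    push_cast; linarith
  have hlower : ((-2 : ℤ) : ℝ) < ((⌊a⌋ + ⌊b⌋ + ⌊c⌋ : ℤ) : ℝ) := by
    push_cast; linarith
  rw [Int.cast_lt] at hupper hlower
  omega

/-- The three strips at angles 0, 2π/3, 4π/3 of half-width 1/3 cover the plane. -/
theorem pyjama_cover_one_third :
    ∀ x : ℝ × ℝ, ∃ j : Fin 3,
      intDist (dot2 (![(Real.cos 0, Real.sin 0),
          (Real.cos (2 * Real.pi / 3), Real.sin (2 * Real.pi / 3)),
          (Real.cos (4 * Real.pi / 3), Real.sin (4 * Real.pi / 3))] j) x) ≤ 1 / 3 := by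
  intro x
  have hcos : Real.cos (2 * Real.pi / 3) = -1 / 2 := by
    rw [show 2 * Real.pi / 3 = Real.pi - Real.pi / 3 by ring, Real.cos_pi_sub,
      Real.cos_pi_div_three]
    norm_num
  have hangle : 4 * Real.pi / 3 = 2 * Real.pi - 2 * Real.pi / 3 := by ring
  have hcos' : Real.cos (4 * Real.pi / 3) = -1 / 2 := by
    rw [hangle, Real.cos_two_pi_sub, hcos]
  have hsin : Real.sin (4 * Real.pi / 3) = -Real.sin (2 * Real.pi / 3) := by
    rw [hangle, Real.sin_two_pi_sub]
  have hsum : dot2 (Real.cos 0, Real.sin 0) x +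
      dot2 (Real.cos (2 * Real.pi / 3), Real.sin (2 * Real.pi / 3)) x +
      dot2 (Real.cos (4 * Real.pi / 3), Real.sin (4 * Real.pi / 3)) x = 0 := by
    simp only [dot2, hcos, hcos', hsin, Real.cos_zero, Real.sin_zero]
    ring
  rcases exists_intDist_le_of_sum_eq_zero hsum with h | h | h
  · exact ⟨0, h⟩
  · exact ⟨1, h⟩
  · exact ⟨2, h⟩
end

section
/- Let u_0, …, u_n ∈ ℝ² be unit vectors that are linearly independent over ℚ (as elements of ℝ² viewed as a vector space over ℚ). Then for every ε < 1/2 there exists a point x ∈ ℝ² such that ‖⟨u_j, x⟩‖ > ε for every j = 0, …, n. In particular, the corresponding finitely many rotated strips of half-width ε do not cover the plane for any ε < 1/2. -/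
open Filter Topology MeasureTheory in
/-- The time average of a nonconstant character of `ℝ` vanishes. -/
theorem tendsto_average_exp {w : ℝ} (hw : w ≠ 0) :
    Tendsto (fun T : ℝ => (T : ℂ)⁻¹ * ∫ t in (0 : ℝ)..T, Complex.exp (w * Complex.I * t))
      atTop (𝓝 0) := by
  have hc : (w : ℂ) * Complex.I ≠ 0 := by simp [hw]
  have hlim : Tendsto (fun T : ℝ => T⁻¹ * (2 / |w|)) atTop (𝓝 0) := by
    simpa using tendsto_inv_atTop_zero.mul_const (2 / |w|)
  refine squeeze_zero_norm' ?_ hlim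
  filter_upwards [eventually_gt_atTop 0] with T hT
  rw [integral_exp_mul_complex hc, norm_mul, norm_inv, Complex.norm_real, Real.norm_of_nonneg hT.le,
    norm_div]
  have hden : ‖(w : ℂ) * Complex.I‖ = |w| := by simp
  rw [hden]
  gcongr
  refine (norm_sub_le _ _).trans ?_
  have h (x : ℝ) : ‖Complex.exp (w * Complex.I * x)‖ = 1 := by
    rw [show (w : ℂ) * Complex.I * x = (w * x : ℝ) * Complex.I by push_cast; ring]
    exact Complex.norm_exp_ofReal_mul_I _
  rw [h, h]
  norm_num

open Filter Topology MeasureTheory in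
/-- Parseval's identity for the time average of a trigonometric polynomial. -/
theorem tendsto_average_norm_sq {M : Type*} (s : Finset M) (c : M → ℂ) (w : M → ℝ)
    (hw : Set.InjOn w s) :
    Tendsto (fun T : ℝ => T⁻¹ * ∫ t in (0 : ℝ)..T,
      ‖∑ m ∈ s, c m * Complex.exp (w m * Complex.I * t)‖ ^ 2) atTop (𝓝 (∑ m ∈ s, ‖c m‖ ^ 2)) := by
  classical
  have hexpand (t : ℝ) : ((‖∑ m ∈ s, c m * Complex.exp (w m * Complex.I * t)‖ ^ 2 : ℝ) : ℂ) =
      ∑ m ∈ s, ∑ l ∈ s, c m * (starRingEnd ℂ) (c l) *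
        Complex.exp ((w m - w l : ℝ) * Complex.I * t) := by
    rw [Complex.ofReal_pow, ← Complex.mul_conj', map_sum, Finset.sum_mul_sum]
    refine Finset.sum_congr rfl fun m _ => Finset.sum_congr rfl fun l _ => ?_
    have h : Complex.exp ((w m - w l : ℝ) * Complex.I * t) =
        Complex.exp (w m * Complex.I * t) * Complex.exp (-(w l * Complex.I * t)) := by
      rw [← Complex.exp_add]
      congr 1
      push_cast
      ring
    rw [h, map_mul, ← Complex.exp_conj]
    simp only [map_mul, Complex.conj_ofReal, Complex.conj_I]
    ring_nf
  have hterm (m l : M) (hm : m ∈ s) (hl : l ∈ s) :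
      Tendsto (fun T : ℝ => (T : ℂ)⁻¹ * ∫ t in (0 : ℝ)..T, c m * (starRingEnd ℂ) (c l) *
        Complex.exp ((w m - w l : ℝ) * Complex.I * t)) atTop
        (𝓝 (if m = l then ((‖c m‖ ^ 2 : ℝ) : ℂ) else 0)) := by
    split_ifs with h
    · subst h
      refine tendsto_const_nhds.congr' ?_
      filter_upwards [eventually_gt_atTop 0] with T hT
      have hT' : (T : ℂ) ≠ 0 := by exact_mod_cast hT.ne'
      simp only [sub_self, Complex.ofReal_zero, zero_mul, Complex.exp_zero, mul_one,
        intervalIntegral.integral_const, sub_zero, Complex.real_smul, Complex.mul_conj']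
      push_cast
      field_simp
    · have hne : w m - w l ≠ 0 := sub_ne_zero.2 fun h' => h (hw hm hl h')
      have := (tendsto_average_exp hne).const_mul (c m * (starRingEnd ℂ) (c l))
      rw [mul_zero] at this
      refine this.congr fun T => ?_
      rw [intervalIntegral.integral_const_mul]
      ring
  have hsum := tendsto_finsetSum s fun m hm => tendsto_finsetSum s fun l hl => hterm m l hm hl
  have hlim : ∑ m ∈ s, ∑ l ∈ s, (if m = l then ((‖c m‖ ^ 2 : ℝ) : ℂ) else 0) =
      ((∑ m ∈ s, ‖c m‖ ^ 2 : ℝ) : ℂ) := by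
    rw [Complex.ofReal_sum]
    exact Finset.sum_congr rfl fun m hm => by rw [Finset.sum_ite_eq, if_pos hm]
  rw [hlim] at hsum
  have hre := (Complex.continuous_re.tendsto _).comp hsum
  rw [Complex.ofReal_re] at hre
  refine hre.congr fun T => ?_
  have hint (m l : M) : IntervalIntegrable (fun t : ℝ => c m * (starRingEnd ℂ) (c l) *
      Complex.exp ((w m - w l : ℝ) * Complex.I * t)) volume 0 T :=
    Continuous.intervalIntegrable (by fun_prop) _ _
  have hint' (m : M) : IntervalIntegrable (fun t : ℝ => ∑ l ∈ s, c m * (starRingEnd ℂ) (c l) *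
      Complex.exp ((w m - w l : ℝ) * Complex.I * t)) volume 0 T :=
    Continuous.intervalIntegrable (by fun_prop) _ _
  have hC : ((T⁻¹ * ∫ t in (0 : ℝ)..T,
      ‖∑ m ∈ s, c m * Complex.exp (w m * Complex.I * t)‖ ^ 2 : ℝ) : ℂ) =
      ∑ m ∈ s, ∑ l ∈ s, (T : ℂ)⁻¹ * ∫ t in (0 : ℝ)..T, c m * (starRingEnd ℂ) (c l) *
        Complex.exp ((w m - w l : ℝ) * Complex.I * t) := by
    rw [Complex.ofReal_mul, Complex.ofReal_inv, ← intervalIntegral.integral_ofReal]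
    simp only [hexpand]
    rw [intervalIntegral.integral_finsetSum fun m _ => hint' m, Finset.mul_sum]
    refine Finset.sum_congr rfl fun m _ => ?_
    rw [intervalIntegral.integral_finsetSum fun l _ => hint m l, Finset.mul_sum]
  rw [Function.comp_apply, ← hC, Complex.ofReal_re]

/-- The Dirichlet kernel with `k` terms along the frequency `a`, shifted by half a period so that it
peaks where `t * a` is a half-integer. -/
noncomputable def shiftedDirichlet (k : ℕ) (a t : ℝ) : ℂ :=
  ∑ m ∈ Finset.range k, (-Complex.exp ((2 * Real.pi * (t * a) : ℝ) * Complex.I)) ^ m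

theorem continuous_shiftedDirichlet (k : ℕ) (a : ℝ) : Continuous (shiftedDirichlet k a) := by
  unfold shiftedDirichlet
  fun_prop

theorem abs_cos_pi_mul (x : ℝ) : |Real.cos (Real.pi * x)| = |Real.cos (Real.pi * intDist x)| := by
  have h : Real.cos (Real.pi * intDist x) = Real.cos (Real.pi * x - round x * Real.pi) := by
    rw [intDist, ← Real.cos_abs (Real.pi * x - round x * Real.pi),
      show Real.pi * x - round x * Real.pi = Real.pi * (x - round x) by ring, abs_mul,
      abs_of_pos Real.pi_pos]
  rw [h, Real.cos_sub_int_mul_pi, abs_mul, abs_zpow, abs_neg, abs_one, one_zpow, one_mul]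

theorem norm_shiftedDirichlet_le {ε : ℝ} (hε : ε < 1 / 2) (k : ℕ) {a t : ℝ}
    (h : intDist (t * a) ≤ ε) :
    ‖shiftedDirichlet k a t‖ ≤ (Real.cos (Real.pi * ε))⁻¹ := by
  have hd : 0 ≤ intDist (t * a) := abs_nonneg _
  have hpi := Real.pi_pos
  have hcos : 0 < Real.cos (Real.pi * ε) :=
    Real.cos_pos_of_mem_Ioo ⟨by nlinarith, by nlinarith⟩
  have hle : Real.cos (Real.pi * ε) ≤ |Real.cos (Real.pi * (t * a))| := by
    rw [abs_cos_pi_mul]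
    refine le_trans ?_ (le_abs_self _)
    exact Real.cos_le_cos_of_nonneg_of_le_pi (by positivity) (by nlinarith) (by gcongr)
  set z : ℂ := -Complex.exp ((2 * Real.pi * (t * a) : ℝ) * Complex.I) with hz
  have hz1 : ‖z‖ = 1 := by rw [hz, norm_neg, Complex.norm_exp_ofReal_mul_I]
  have hz2 : ‖z - 1‖ = 2 * |Real.cos (Real.pi * (t * a))| := by
    have : z = Complex.exp (Complex.I * (2 * Real.pi * (t * a) + Real.pi : ℝ)) := by
      rw [Complex.ofReal_add, mul_add, mul_comm Complex.I (Real.pi : ℂ), Complex.exp_add,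
        Complex.exp_pi_mul_I, hz, mul_comm Complex.I]
      ring
    rw [this, Complex.norm_exp_I_mul_ofReal_sub_one,
      show (2 * Real.pi * (t * a) + Real.pi) / 2 = Real.pi * (t * a) + Real.pi / 2 by ring,
      Real.sin_add_pi_div_two, norm_mul, Real.norm_eq_abs, Real.norm_eq_abs, abs_two]
  have hgeom : ‖shiftedDirichlet k a t‖ * ‖z - 1‖ ≤ 2 := by
    rw [shiftedDirichlet, ← norm_mul, ← hz, geom_sum_mul]
    refine (norm_sub_le _ _).trans ?_
    rw [norm_pow, hz1, one_pow, norm_one]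
    norm_num
  rw [hz2] at hgeom
  rw [← one_div, le_div_iff₀ hcos]
  nlinarith [mul_le_mul_of_nonneg_left hle (norm_nonneg (shiftedDirichlet k a t))]

open Filter Topology MeasureTheory in
theorem tendsto_average_prod_shiftedDirichlet {ι : Type*} [Fintype ι] {a : ι → ℝ}
    (ha : LinearIndependent ℚ a) (k : ι → ℕ) :
    Tendsto (fun T : ℝ => T⁻¹ * ∫ t in (0 : ℝ)..T, ‖∏ j, shiftedDirichlet (k j) (a j) t‖ ^ 2)
      atTop (𝓝 (∏ j, (k j : ℝ))) := by
  classical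
  have hinj : Set.InjOn (fun m : ι → ℕ => 2 * Real.pi * ∑ j, m j * a j)
      (Fintype.piFinset fun j => Finset.range (k j)) := by
    intro m _ l _ h
    have h' : ∑ j, (m j : ℝ) * a j = ∑ j, (l j : ℝ) * a j :=
      mul_left_cancel₀ (by positivity) h
    have h0 := Fintype.linearIndependent_iff.1 ha (fun j => (m j : ℚ) - l j) (by
      simp only [Rat.smul_def]
      push_cast
      simp only [sub_mul, Finset.sum_sub_distrib, h', sub_self])
    funext j
    exact_mod_cast sub_eq_zero.1 (h0 j)
  have key := tendsto_average_norm_sq (Fintype.piFinset fun j => Finset.range (k j))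
    (fun m => ∏ j, (-1 : ℂ) ^ m j) _ hinj
  have hlim : ∑ m ∈ Fintype.piFinset fun j => Finset.range (k j), ‖∏ j, (-1 : ℂ) ^ m j‖ ^ 2 =
      ∏ j, (k j : ℝ) := by
    simp [norm_prod]
  rw [hlim] at key
  refine key.congr fun T => ?_
  congr 2
  funext t
  congr 2
  simp only [shiftedDirichlet]
  rw [Finset.prod_univ_sum]
  refine Finset.sum_congr rfl fun m _ => ?_
  have hexp : Complex.exp ((2 * Real.pi * ∑ j, m j * a j : ℝ) * Complex.I * t) =
      ∏ j, Complex.exp ((2 * Real.pi * (t * a j) : ℝ) * Complex.I) ^ m j := by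
    simp only [← Complex.exp_nat_mul]
    rw [← Complex.exp_sum]
    congr 1
    push_cast
    simp only [Finset.mul_sum, Finset.sum_mul]
    exact Finset.sum_congr rfl fun j _ => by ring
  rw [hexp, ← Finset.prod_mul_distrib]
  exact Finset.prod_congr rfl fun j _ => by rw [← mul_pow, neg_one_mul]

open Filter Topology MeasureTheory in
/-- A form of Kronecker's approximation theorem: multiples of rationally independent reals come
simultaneously close to half-integers. -/
theorem exists_forall_lt_intDist_mul {ι : Type*} [Fintype ι] {a : ι → ℝ}
    (ha : LinearIndependent ℚ a) {ε : ℝ} (hε : ε < 1 / 2) :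
    ∃ t : ℝ, ∀ j, ε < intDist (t * a j) := by
  classical
  by_contra! hcover
  set C : ℝ := ((Real.cos (Real.pi * ε))⁻¹) ^ 2 with hC
  obtain ⟨K, hK⟩ := exists_nat_gt (C * Fintype.card ι)
  have hKpos : (0 : ℝ) < K := lt_of_le_of_lt (by positivity) hK
  let k (j : ι) : ι → ℕ := Function.update (fun _ => K) j 1
  let P (κ : ι → ℕ) (t : ℝ) : ℝ := ‖∏ j, shiftedDirichlet (κ j) (a j) t‖ ^ 2
  have hPcont (κ : ι → ℕ) : Continuous (P κ) :=
    (continuous_finsetProd _ fun j _ => continuous_shiftedDirichlet (κ j) (a j)).norm.pow 2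
  have hpoint (t : ℝ) : P (fun _ => K) t ≤ C * ∑ j, P (k j) t := by
    obtain ⟨j, hj⟩ := hcover t
    have hfactor : P (fun _ => K) t = ‖shiftedDirichlet K (a j) t‖ ^ 2 * P (k j) t := by
      simp only [P]
      rw [← mul_pow, ← norm_mul, ← Finset.mul_prod_erase _ _ (Finset.mem_univ j),
        ← Finset.mul_prod_erase _ (fun i => shiftedDirichlet (k j i) (a i) t) (Finset.mem_univ j)]
      have h1 : shiftedDirichlet (k j j) (a j) t = 1 := by simp [k, shiftedDirichlet]
      rw [h1, one_mul]
      congr 3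
      exact Finset.prod_congr rfl fun i hi => by simp [k, Finset.ne_of_mem_erase hi]
    rw [hfactor]
    refine mul_le_mul ?_ ?_ (sq_nonneg _) (sq_nonneg _)
    · exact pow_le_pow_left₀ (norm_nonneg _) (norm_shiftedDirichlet_le hε K hj) 2
    · exact Finset.single_le_sum (f := fun i => P (k i) t) (fun i _ => sq_nonneg _)
        (Finset.mem_univ j)
  have hleft := tendsto_average_prod_shiftedDirichlet ha fun _ => K
  have hright := (tendsto_finsetSum Finset.univ fun j _ =>
    tendsto_average_prod_shiftedDirichlet ha (k j)).const_mul C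
  have hle := le_of_tendsto_of_tendsto hleft hright (by
    filter_upwards [eventually_gt_atTop 0] with T hT
    rw [← Finset.mul_sum, ← intervalIntegral.integral_finsetSum fun j _ =>
      (hPcont (k j)).intervalIntegrable _ _, mul_left_comm,
      ← intervalIntegral.integral_const_mul C]
    refine mul_le_mul_of_nonneg_left ?_ (inv_nonneg.2 hT.le)
    refine intervalIntegral.integral_mono_on hT.le ((hPcont _).intervalIntegrable _ _)
      (Continuous.intervalIntegrable ?_ _ _) fun t _ => hpoint t
    exact continuous_const.mul (continuous_finsetSum _ fun j _ => hPcont (k j)))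
  have hprod (j : ι) : (K : ℝ) * ∏ i, (k j i : ℝ) = ∏ _i : ι, (K : ℝ) := by
    rw [← Finset.mul_prod_erase _ _ (Finset.mem_univ j),
      ← Finset.mul_prod_erase _ (fun _ => (K : ℝ)) (Finset.mem_univ j)]
    have h1 : (k j j : ℝ) = 1 := by simp [k]
    rw [h1, one_mul]
    congr 1
    exact Finset.prod_congr rfl fun i hi => by simp [k, Finset.ne_of_mem_erase hi]
  have hpow : 0 < ∏ _i : ι, (K : ℝ) := Finset.prod_pos fun _ _ => hKpos
  have hle' : K * ∏ _i : ι, (K : ℝ) ≤ C * Fintype.card ι * ∏ _i : ι, (K : ℝ) := by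
    calc K * ∏ _i : ι, (K : ℝ) ≤ K * (C * ∑ j, ∏ i, (k j i : ℝ)) := by gcongr
      _ = C * ∑ j, K * ∏ i, (k j i : ℝ) := by rw [← Finset.mul_sum]; ring
      _ = C * Fintype.card ι * ∏ _i : ι, (K : ℝ) := by
        simp only [hprod, Finset.sum_const, Finset.card_univ, nsmul_eq_mul]
        ring
  exact absurd (le_of_mul_le_mul_right hle' hpow) (not_le.2 hK)

/-- Rationally independent vectors of the plane stay rationally independent under a suitable linear
functional. -/
theorem exists_linearIndependent_fst_add_mul_snd {ι : Type*} [Finite ι] {u : ι → ℝ × ℝ}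
    (hu : LinearIndependent ℚ u) :
    ∃ s : ℝ, LinearIndependent ℚ fun j => (u j).1 + s * (u j).2 := by
  have := Fintype.ofFinite ι
  let w (q : ι → ℚ) : ℝ × ℝ := ∑ j, q j • u j
  have hcount : (Set.range fun q => -(w q).1 / (w q).2).Countable := Set.countable_range _
  obtain ⟨s, hs⟩ : ∃ s : ℝ, s ∉ Set.range fun q => -(w q).1 / (w q).2 := by
    by_contra! h
    exact Set.not_countable_univ (hcount.mono fun s _ => h s)
  refine ⟨s, Fintype.linearIndependent_iff.2 fun q hq => ?_⟩
  have hsum : (w q).1 + s * (w q).2 = 0 := by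
    rw [← hq]
    simp only [w, Prod.fst_sum, Prod.snd_sum, Prod.smul_fst, Prod.smul_snd, Finset.mul_sum,
      ← Finset.sum_add_distrib, Rat.smul_def]
    exact Finset.sum_congr rfl fun j _ => by ring
  have h2 : (w q).2 = 0 := by
    by_contra h
    exact hs ⟨q, by field_simp; linarith⟩
  have h1 : (w q).1 = 0 := by simpa [h2] using hsum
  exact Fintype.linearIndependent_iff.1 hu q (Prod.ext h1 h2)

/-- If the unit vectors `u 0, …, u n` are linearly independent over `ℚ`, then for every
`ε < 1/2` there is a point `x` of the plane with `‖⟨u j, x⟩‖ > ε` for all `j`;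
in particular the corresponding strips of half-width `ε` do not cover the plane. -/
theorem no_cover_of_rationally_independent (n : ℕ) (u : Fin (n + 1) → ℝ × ℝ)
    (hunit : ∀ j, (u j).1 ^ 2 + (u j).2 ^ 2 = 1)
    (hindep : LinearIndependent ℚ u) :
    ∀ ε : ℝ, ε < 1 / 2 → ∃ x : ℝ × ℝ, ∀ j, ε < intDist (dot2 (u j) x) := by
  intro ε hε
  obtain ⟨s, hs⟩ := exists_linearIndependent_fst_add_mul_snd hindep
  obtain ⟨t, ht⟩ := exists_forall_lt_intDist_mul hs hε
  refine ⟨(t, t * s), fun j => ?_⟩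
  convert ht j using 2
  simp only [dot2]
  ring
end

section
/- Let n ≥ 1 and let u_0, …, u_n ∈ ℝ² be pairwise distinct unit vectors such that u_0 and u_1 are linearly independent over ℝ. Then the family u_0, …, u_n is periodic (i.e., admits two ℝ-linearly independent period vectors) if and only if the dimension over ℚ of the ℚ-linear span of {u_0, …, u_n} equals 2. -/
/-- `v` is a period vector of the family `u` if `⟨u j, v⟩ ∈ ℤ` for all `j`. -/
def IsPeriodVector {m : ℕ} (u : Fin m → ℝ × ℝ) (v : ℝ × ℝ) : Prop :=
  ∀ j, ∃ z : ℤ, dot2 (u j) v = z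

/-- The family `u` is (fully) periodic if it admits two ℝ-linearly independent
period vectors. -/
def IsPeriodicFamily {m : ℕ} (u : Fin m → ℝ × ℝ) : Prop :=
  ∃ v w : ℝ × ℝ, LinearIndependent ℝ ![v, w] ∧ IsPeriodVector u v ∧ IsPeriodVector u w

theorem linearIndependent_pair_iff_det_ne_zero (a b : ℝ × ℝ) :
    LinearIndependent ℝ ![a, b] ↔ a.1 * b.2 - a.2 * b.1 ≠ 0 := by
  rw [LinearIndependent.pair_iff]
  constructor
  · intro h hdet
    have hb := h b.2 (-a.2) (by ext <;> simp <;> linarith)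
    have ha := h b.1 (-a.1) (by ext <;> simp <;> linarith)
    have := h 1 0 (by ext <;> simp <;> linarith)
    exact one_ne_zero this.1
  · intro hdet s t h
    have h1 : s * a.1 + t * b.1 = 0 := by simpa using congrArg Prod.fst h
    have h2 : s * a.2 + t * b.2 = 0 := by simpa using congrArg Prod.snd h
    constructor
    · refine (mul_eq_zero.1 ?_).resolve_right hdet
      linear_combination b.2 * h1 - b.1 * h2
    · refine (mul_eq_zero.1 ?_).resolve_right hdet
      linear_combination a.1 * h2 - a.2 * h1

/-- The coordinates of a vector in the basis dual to `v, w` are its inner products with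
`v` and `w`. -/
theorem exists_dual_basis {v w : ℝ × ℝ} (h : LinearIndependent ℝ ![v, w]) :
    ∃ p q : ℝ × ℝ, ∀ x, x = dot2 x v • p + dot2 x w • q := by
  have hdet := (linearIndependent_pair_iff_det_ne_zero v w).1 h
  refine ⟨(w.2 / (v.1 * w.2 - v.2 * w.1), -w.1 / (v.1 * w.2 - v.2 * w.1)),
    (-v.2 / (v.1 * w.2 - v.2 * w.1), v.1 / (v.1 * w.2 - v.2 * w.1)), fun x ↦ ?_⟩
  ext <;> simp [dot2] <;> field_simp <;> ring

theorem IsPeriodicFamily.rank_span_le {m : ℕ} {u : Fin m → ℝ × ℝ} (h : IsPeriodicFamily u) :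
    Module.rank ℚ (Submodule.span ℚ (Set.range u)) ≤ 2 := by
  classical
  obtain ⟨v, w, hvw, hv, hw⟩ := h
  obtain ⟨p, q, hpq⟩ := exists_dual_basis hvw
  have hle : Submodule.span ℚ (Set.range u) ≤
      Submodule.span ℚ (({p, q} : Finset (ℝ × ℝ)) : Set (ℝ × ℝ)) := by
    rw [Submodule.span_le]
    rintro _ ⟨j, rfl⟩
    obtain ⟨a, ha⟩ := hv j
    obtain ⟨b, hb⟩ := hw j
    rw [Finset.coe_pair, SetLike.mem_coe, Submodule.mem_span_pair]
    refine ⟨a, b, ?_⟩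
    rw [hpq (u j), ha, hb]
    simp [Int.cast_smul_eq_zsmul]
  calc Module.rank ℚ (Submodule.span ℚ (Set.range u))
      ≤ _ := Submodule.rank_mono hle
    _ ≤ (({p, q} : Finset (ℝ × ℝ)).card : Cardinal) := rank_span_finset_le _
    _ ≤ 2 := by exact_mod_cast Finset.card_le_two

theorem exists_common_denominator {ι : Type*} [Finite ι] (f : ι → ℚ) :
    ∃ N : ℤ, N ≠ 0 ∧ ∀ i, ∃ z : ℤ, (N * f i : ℚ) = z := by
  obtain ⟨b, hb⟩ := IsLocalization.exist_integer_multiples_of_finite (nonZeroDivisors ℤ) f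
  refine ⟨b, nonZeroDivisors.coe_ne_zero b, fun i ↦ ?_⟩
  obtain ⟨z, hz⟩ := hb i
  exact ⟨z, by simpa using hz.symm⟩

theorem isPeriodicFamily_of_mem_span_pair {m : ℕ} {u : Fin m → ℝ × ℝ} {a b : ℝ × ℝ}
    (hab : LinearIndependent ℝ ![a, b]) (h : ∀ j, u j ∈ Submodule.span ℚ {a, b}) :
    IsPeriodicFamily u := by
  have hdet := (linearIndependent_pair_iff_det_ne_zero a b).1 hab
  simp only [Submodule.mem_span_pair] at h
  choose q r hqr using h
  obtain ⟨M, hM, hq⟩ := exists_common_denominator q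
  obtain ⟨N, hN, hr⟩ := exists_common_denominator r
  have hM' : (M : ℝ) ≠ 0 := by exact_mod_cast hM
  have hN' : (N : ℝ) ≠ 0 := by exact_mod_cast hN
  have h1 (j) : q j * a.1 + r j * b.1 = (u j).1 := by simp [← hqr j, Rat.smul_def]
  have h2 (j) : q j * a.2 + r j * b.2 = (u j).2 := by simp [← hqr j, Rat.smul_def]
  set d := a.1 * b.2 - a.2 * b.1 with hd
  refine ⟨(M * b.2 / d, -(M * b.1 / d)), (-(N * a.2 / d), N * a.1 / d), ?_, ?_, ?_⟩
  · rw [linearIndependent_pair_iff_det_ne_zero]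
    have : M * b.2 / d * (N * a.1 / d) - -(M * b.1 / d) * -(N * a.2 / d) = M * N / d := by
      field_simp
      rw [hd]
      ring
    simpa only [this] using div_ne_zero (mul_ne_zero hM' hN') hdet
  · intro j
    obtain ⟨z, hz⟩ := hq j
    refine ⟨z, ?_⟩
    have hz' : (M * q j : ℝ) = z := by exact_mod_cast hz
    rw [← hz', dot2, ← h1, ← h2]
    field_simp
    rw [hd]
    ring
  · intro j
    obtain ⟨z, hz⟩ := hr j
    refine ⟨z, ?_⟩
    have hz' : (N * r j : ℝ) = z := by exact_mod_cast hz
    rw [← hz', dot2, ← h1, ← h2]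
    field_simp
    rw [hd]
    ring

/-- For `n ≥ 1` and pairwise distinct unit vectors `u 0, …, u n` with `u 0, u 1`
ℝ-linearly independent, the family is periodic iff the ℚ-span of the vectors has
dimension 2 over ℚ. -/
theorem periodic_iff_rank_two (n : ℕ) (hn : 1 ≤ n) (u : Fin (n + 1) → ℝ × ℝ)
    (hdist : Function.Injective u)
    (hunit : ∀ j, (u j).1 ^ 2 + (u j).2 ^ 2 = 1)
    (h01 : LinearIndependent ℝ ![u 0, u 1]) :
    IsPeriodicFamily u ↔ Module.rank ℚ (Submodule.span ℚ (Set.range u)) = 2 := by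
  have hli : LinearIndependent ℚ ![u 0, u 1] := h01.restrict_scalars' ℚ
  have hle : Submodule.span ℚ {u 0, u 1} ≤ Submodule.span ℚ (Set.range u) :=
    Submodule.span_mono (by rintro _ (rfl | rfl) <;> exact Set.mem_range_self _)
  have hrank : Module.rank ℚ (Submodule.span ℚ {u 0, u 1}) = 2 := by
    have := rank_span hli
    rwa [Cardinal.mk_range_eq _ hli.injective, Cardinal.mk_fin, Matrix.range_cons_cons_empty] at this
  constructor
  · intro h
    exact le_antisymm h.rank_span_le (hrank ▸ Submodule.rank_mono hle)
  · intro h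
    have : FiniteDimensional ℚ (Submodule.span ℚ (Set.range u)) :=
      FiniteDimensional.span_of_finite ℚ (Set.finite_range u)
    have heq := Submodule.eq_of_le_of_finrank_eq hle (by simp only [Module.finrank, hrank, h])
    exact isPeriodicFamily_of_mem_span_pair h01 fun j ↦
      heq ▸ Submodule.subset_span (Set.mem_range_self j)
end

section
/- Let n ≥ 2 and let θ_0 = 0, θ_1, …, θ_n be pairwise distinct angles in [0, π) such that the family of unit vectors u_j = (cos θ_j, sin θ_j), j = 0, …, n, is periodic. Then cos θ_j is rational for every j, and there exists a squarefree positive integer D such that all the complex numbers e^{iθ_j} (j = 0, …, n) belong to the imaginary quadratic field ℚ(√−D) ⊂ ℂ. -/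
open IntermediateField

/-- If a periodic family contains `(1, 0)`, all its vectors are rational combinations of
`(1, 0)` and one fixed vector `(r, s)`. -/
lemma IsPeriodicFamily.exists_rat_combination {m : ℕ} {u : Fin m → ℝ × ℝ}
    (hu : IsPeriodicFamily u) {i : Fin m} (hi : u i = (1, 0)) :
    ∃ r s : ℝ, s ≠ 0 ∧ ∀ j, ∃ q p : ℚ, (u j).1 = q + p * r ∧ (u j).2 = p * s := by
  obtain ⟨v, w, hvw, hv, hw⟩ := hu
  rw [LinearIndependent.pair_iff] at hvw
  have hdet : w.1 * v.2 - v.1 * w.2 ≠ 0 := by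
    intro h
    have h₁ := hvw w.1 (-v.1) (Prod.ext (by simp; ring) (by simp; linarith))
    have h₂ := hvw w.2 (-v.2) (Prod.ext (by simp; linarith) (by simp; ring))
    have h₃ := hvw 1 0 (Prod.ext (by simpa using h₁.2) (by simpa using h₂.2))
    exact one_ne_zero h₃.1
  clear hvw
  obtain ⟨a, ha⟩ := hv i
  obtain ⟨b, hb⟩ := hw i
  simp only [dot2, hi, one_mul, zero_mul, add_zero] at ha hb
  wlog ha0 : a ≠ 0 generalizing v w a b
  · push Not at ha0
    refine this w v hw hv ?_ b a hb ha ?_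
    · intro h
      exact hdet (by linarith)
    · rintro rfl
      exact hdet (by simp [ha, hb, ha0])
  rw [ha, hb] at hdet
  have ha0' : (a : ℝ) ≠ 0 := by exact_mod_cast ha0
  refine ⟨-v.2 / (a * (b * v.2 - a * w.2)), 1 / (b * v.2 - a * w.2), one_div_ne_zero hdet,
    fun j => ?_⟩
  obtain ⟨m, hm⟩ := hv j
  obtain ⟨k, hk⟩ := hw j
  simp only [dot2, ha, hb] at hm hk
  have hs : (u j).2 = (b * m - a * k) * (1 / (b * v.2 - a * w.2)) := by
    rw [← hm, ← hk, mul_one_div, eq_div_iff hdet]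
    ring
  refine ⟨m / a, b * m - a * k, ?_, by push_cast; exact hs⟩
  push_cast
  have hc : (u j).1 = m / a - (u j).2 * (v.2 / a) := by
    field_simp
    linarith
  rw [hc, hs]
  field_simp
  ring

/-- Two non-proportional rational pairs `(q, p)` for which `(q + p r, p s)` is a unit vector force
`r` and `s ^ 2` to be rational. -/
lemma exists_rat_of_unit_combinations {r s : ℝ} {q₁ p₁ q₂ p₂ : ℚ} (hp₁ : p₁ ≠ 0) (hp₂ : p₂ ≠ 0)
    (h₁ : (q₁ + p₁ * r) ^ 2 + (p₁ * s) ^ 2 = 1) (h₂ : (q₂ + p₂ * r) ^ 2 + (p₂ * s) ^ 2 = 1)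
    (hne : q₁ * p₂ - q₂ * p₁ ≠ 0) : (∃ a : ℚ, r = a) ∧ ∃ b : ℚ, s ^ 2 = b := by
  have hp₁' : (p₁ : ℝ) ≠ 0 := by exact_mod_cast hp₁
  have hp₂' : (p₂ : ℝ) ≠ 0 := by exact_mod_cast hp₂
  have hne' : (q₁ * p₂ - q₂ * p₁ : ℝ) ≠ 0 := by exact_mod_cast hne
  obtain ⟨a, ha⟩ : ∃ a : ℚ, r = a := by
    refine ⟨((1 - q₁ ^ 2) * p₂ ^ 2 - (1 - q₂ ^ 2) * p₁ ^ 2) /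
      (2 * p₁ * p₂ * (q₁ * p₂ - q₂ * p₁)), ?_⟩
    push_cast
    rw [eq_div_iff (by positivity)]
    linear_combination (p₂ : ℝ) ^ 2 * h₁ - (p₁ : ℝ) ^ 2 * h₂
  refine ⟨⟨a, ha⟩, (1 - (q₁ + p₁ * a) ^ 2) / p₁ ^ 2, ?_⟩
  push_cast
  rw [eq_div_iff (by positivity), ← ha]
  linear_combination h₁

/-- A nonzero real number with rational square is a rational multiple of the square root of a
squarefree positive integer. -/
lemma exists_squarefree_sqrt_of_sq_eq_rat {s : ℝ} (hs : s ≠ 0) {b : ℚ} (hb : s ^ 2 = b) :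
    ∃ D : ℕ, 0 < D ∧ Squarefree D ∧ ∃ k : ℚ, s = k * √D := by
  have hb0 : 0 < b := by
    have : (0 : ℝ) < b := hb ▸ by positivity
    exact_mod_cast this
  obtain ⟨N, hN⟩ := Int.eq_ofNat_of_zero_le (Rat.num_pos.2 hb0).le
  obtain ⟨D, c, hcD, hD⟩ := Nat.sq_mul_squarefree (N * b.den)
  have hden : (b.den : ℝ) ≠ 0 := by exact_mod_cast b.den_nz
  have hbN : (b : ℝ) * b.den = N := by
    have := Rat.mul_den_eq_num b
    rw [hN] at this
    exact_mod_cast this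
  have hcD' : (c : ℝ) ^ 2 * D = N * b.den := by exact_mod_cast hcD
  have hsq : s ^ 2 = (c / b.den * √D) ^ 2 := by
    rw [hb, mul_pow, Real.sq_sqrt D.cast_nonneg, div_pow, div_mul_eq_mul_div, hcD',
      eq_div_iff (by positivity), ← hbN]
    ring
  refine ⟨D, Nat.pos_of_ne_zero hD.ne_zero, hD, ?_⟩
  rcases sq_eq_sq_iff_eq_or_eq_neg.1 hsq with h | h
  · exact ⟨c / b.den, by rw [h]; push_cast; rfl⟩
  · exact ⟨-(c / b.den), by rw [h]; push_cast; ring⟩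

/-- If `cos x` is rational and `sin x` is a rational multiple of `√D`, then `exp (i x)` lies in
`ℚ(√-D)`. -/
lemma exp_mul_I_mem_adjoin {x : ℝ} {D : ℕ} {q k : ℚ} (hc : Real.cos x = q)
    (hs : Real.sin x = k * √D) :
    Complex.exp (x * Complex.I) ∈ ℚ⟮(Real.sqrt D : ℂ) * Complex.I⟯ := by
  rw [Complex.exp_mul_I, ← Complex.ofReal_cos, ← Complex.ofReal_sin, hc, hs]
  push_cast
  rw [mul_assoc]
  exact add_mem (IntermediateField.algebraMap_mem _ q)
    (mul_mem (IntermediateField.algebraMap_mem _ k) (mem_adjoin_simple_self ℚ _))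

/-- If `n ≥ 2`, the angles `θ 0 = 0, θ 1, …, θ n ∈ [0, π)` are pairwise distinct and
the family of unit vectors `(cos θ j, sin θ j)` is periodic, then all `cos θ j` are
rational and all `exp (i θ j)` lie in a common imaginary quadratic field `ℚ(√-D)`
with `D` a squarefree positive integer. -/
theorem periodic_family_in_quadratic_field (n : ℕ) (hn : 2 ≤ n)
    (θ : Fin (n + 1) → ℝ) (hθ0 : θ 0 = 0)
    (hrange : ∀ j, 0 ≤ θ j ∧ θ j < Real.pi)
    (hdist : Function.Injective θ)
    (hper : IsPeriodicFamily (fun j => (Real.cos (θ j), Real.sin (θ j)))) :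
    (∀ j, ∃ q : ℚ, Real.cos (θ j) = q) ∧
      ∃ D : ℕ, 0 < D ∧ Squarefree D ∧
        ∀ j, Complex.exp (θ j * Complex.I) ∈ ℚ⟮(Real.sqrt D : ℂ) * Complex.I⟯ := by
  obtain ⟨r, s, hs, h⟩ := hper.exists_rat_combination (i := 0) (by simp [hθ0])
  choose q p hc hsin using h
  dsimp only at hc hsin
  have hp : ∀ j ≠ 0, p j ≠ 0 := by
    intro j hj h0
    have hpos : 0 < θ j := lt_of_le_of_ne (hrange j).1 fun h => hj (hdist (by rw [hθ0, h]))
    have := Real.sin_pos_of_pos_of_lt_pi hpos (hrange j).2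
    simp [hsin, h0] at this
  have hunit : ∀ j, (q j + p j * r) ^ 2 + (p j * s) ^ 2 = 1 := by
    intro j
    rw [← hc, ← hsin]
    exact Real.cos_sq_add_sin_sq _
  have hne : ∀ i j, i ≠ j → q i * p j - q j * p i ≠ 0 := by
    intro i j hij h0
    have h0' : (q i * p j - q j * p i : ℝ) = 0 := by exact_mod_cast h0
    have hsub : Real.sin (θ j - θ i) = 0 := by
      rw [Real.sin_sub, hc, hc, hsin, hsin]
      linear_combination s * h0'
    have hi := hrange i
    have hj := hrange j
    rw [Real.sin_eq_zero_iff_of_lt_of_lt (by linarith) (by linarith)] at hsub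
    exact hij (hdist (by linarith))
  let i : Fin (n + 1) := ⟨1, by lia⟩
  let j : Fin (n + 1) := ⟨2, by lia⟩
  obtain ⟨⟨a, ha⟩, b, hb⟩ := exists_rat_of_unit_combinations
    (hp i (by simp [i, Fin.ext_iff])) (hp j (by simp [j, Fin.ext_iff])) (hunit i) (hunit j)
    (hne i j (by simp [i, j]))
  have hcos : ∀ j, Real.cos (θ j) = (q j + p j * a : ℚ) := by
    intro j
    rw [hc, ha]
    push_cast
    rfl
  obtain ⟨D, hD0, hD, k, hk⟩ := exists_squarefree_sqrt_of_sq_eq_rat hs hb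
  refine ⟨fun j => ⟨_, hcos j⟩, D, hD0, hD, fun j => ?_⟩
  refine exp_mul_I_mem_adjoin (k := p j * k) (hcos j) ?_
  rw [hsin, hk]
  push_cast
  ring
end

section
/- Let ε < 1/3, let θ_0, …, θ_n be pairwise distinct angles, and suppose that the family of unit vectors u_j = (cos θ_j, sin θ_j), j = 0, …, n, is periodic. Then the union of the rotated strips ⋃_{j=0}^{n} R_{θ_j} E_ε does not cover the whole plane; that is, there exists a point x ∈ ℝ² with ‖⟨u_j, x⟩‖ > ε for every j = 0, …, n. -/
lemma one_third_le_intDist_of_sub_int {t : ℝ} (k : ℤ) (h₁ : 1 / 3 ≤ |t - k|)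
    (h₂ : |t - k| ≤ 1 / 2) : 1 / 3 ≤ intDist t := by
  unfold intDist
  generalize round t = z
  rcases eq_or_ne k z with rfl | hne
  · exact h₁
  · have h : (1 : ℝ) ≤ |(k : ℝ) - z| := by
      exact_mod_cast Int.one_le_abs (sub_ne_zero.mpr hne)
    have h' : |(k : ℝ) - z| ≤ |t - k| + |t - z| := by
      rw [abs_sub_comm t k]
      exact abs_sub_le _ _ _
    linarith

/-- A multiple of `1 / p` whose numerator is `± ⌊p / 2⌋` modulo the prime `p` is at distance at
least `1 / 3` from the integers. -/
lemma one_third_le_intDist_div_prime {p : ℕ} (hp : p.Prime) {K : ℤ}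
    (hK : (p : ℤ) ∣ K - (p / 2 : ℕ) ∨ (p : ℤ) ∣ K + (p / 2 : ℕ)) :
    1 / 3 ≤ intDist ((K : ℝ) / p) := by
  have hp0 : (0 : ℝ) < p := by exact_mod_cast hp.pos
  have h₁ : (1 : ℝ) / 3 ≤ ((p / 2 : ℕ) : ℝ) / p := by
    rw [div_le_div_iff₀ (by norm_num) hp0]
    have := hp.two_le
    have : 1 * p ≤ (p / 2) * 3 := by omega
    exact_mod_cast this
  have h₂ : ((p / 2 : ℕ) : ℝ) / p ≤ 1 / 2 := by
    rw [div_le_div_iff₀ hp0 (by norm_num)]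
    have : (p / 2) * 2 ≤ 1 * p := by omega
    exact_mod_cast this
  have h₀ : (0 : ℝ) ≤ ((p / 2 : ℕ) : ℝ) / p := by positivity
  generalize p / 2 = h at *
  rcases hK with ⟨k, hk⟩ | ⟨k, hk⟩
  · have hk' : (K : ℝ) - (h : ℝ) = p * k := by exact_mod_cast hk
    have : (K : ℝ) / p - k = (h : ℝ) / p := by
      field_simp
      linarith
    apply one_third_le_intDist_of_sub_int k <;> rwa [this, abs_of_nonneg h₀]
  · have hk' : (K : ℝ) + (h : ℝ) = p * k := by exact_mod_cast hk
    have : (K : ℝ) / p - k = -((h : ℝ) / p) := by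
      field_simp
      linarith
    apply one_third_le_intDist_of_sub_int k <;> rwa [this, abs_neg, abs_of_nonneg h₀]

/-- Finitely many `p`-integral fractions congruent to `± 1` modulo `p` can be scaled simultaneously
to lie at distance at least `1 / 3` from the integers. -/
lemma exists_scaling_of_congr {ι : Type*} [Fintype ι] {p : ℕ} (hp : p.Prime) (Y C : ι → ℤ)
    (hC : ∀ j, ¬ (p : ℤ) ∣ C j)
    (hY : ∀ j, (p : ℤ) ∣ Y j - C j ∨ (p : ℤ) ∣ Y j + C j) :
    ∃ s : ℝ, ∀ j, 1 / 3 ≤ intDist (s * (Y j / C j)) := by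
  classical
  have hpZ : Prime (p : ℤ) := Nat.prime_iff_prime_int.mp hp
  set N : ℤ := ∏ j, C j with hN
  have hpN : ¬ (p : ℤ) ∣ N := fun h => by
    obtain ⟨j, -, hj⟩ := hpZ.exists_mem_finset_dvd h
    exact hC j hj
  have hcop : IsCoprime (p : ℤ) N := (hpZ.coprime_iff_not_dvd).mpr hpN
  obtain ⟨a, b, hab⟩ := hcop
  set h : ℤ := ((p / 2 : ℕ) : ℤ) with hh
  refine ⟨(N * (b * h) : ℤ) / p, fun j => ?_⟩
  obtain ⟨M, hM⟩ : C j ∣ N := Finset.dvd_prod_of_mem C (Finset.mem_univ j)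
  have hC0 : (C j : ℝ) ≠ 0 := by
    intro h0
    exact hC j (by rw [Int.cast_eq_zero.mp h0]; exact dvd_zero _)
  have hval : ((N * (b * h) : ℤ) : ℝ) / p * (Y j / C j) = ((M * (b * h) * Y j : ℤ) : ℝ) / p := by
    rw [hM]
    push_cast
    field_simp
  rw [hval]
  apply one_third_le_intDist_div_prime hp
  rw [← hh]
  rcases hY j with ⟨k, hk⟩ | ⟨k, hk⟩
  · left
    refine ⟨M * (b * h) * k - a * h, ?_⟩
    linear_combination (M * (b * h)) * hk + (b * h) * (-hM) + h * hab
  · right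
    refine ⟨M * (b * h) * k + a * h, ?_⟩
    linear_combination (M * (b * h)) * hk + (b * h) * hM - h * hab

/-- A rational point on `x² + d y² = 1`, for squarefree `d`, has the form `(A / C, B / C)` with
`A` and `C` coprime. -/
lemma exists_int_of_rat_conic {d : ℕ} (hd : Squarefree d) {α β : ℚ}
    (h : α ^ 2 + d * β ^ 2 = 1) :
    ∃ A B C : ℤ, IsCoprime A C ∧ C ≠ 0 ∧ α = A / C ∧ β = B / C ∧ A ^ 2 + d * B ^ 2 = C ^ 2 := by
  have hd0 : (d : ℚ) ≠ 0 := by exact_mod_cast hd.ne_zero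
  have hC0 : (α.den : ℚ) ≠ 0 := by exact_mod_cast α.den_ne_zero
  have hα : α = α.num / α.den := α.num_div_den.symm
  have hsq : (d * β * α.den) ^ 2 = ((d * ((α.den : ℤ) ^ 2 - α.num ^ 2) : ℤ) : ℚ) := by
    have h1 : α * α.den = α.num := Rat.mul_den_eq_num α
    push_cast
    rw [← h1]
    linear_combination (d : ℚ) * (α.den : ℚ) ^ 2 * h
  obtain ⟨m, hm⟩ : ∃ m : ℤ, (m : ℚ) = d * β * α.den := by
    have hint : IsIntegral ℤ ((d * β * α.den : ℚ) ^ 2) := by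
      rw [hsq]
      exact isIntegral_algebraMap
    obtain ⟨m, hm⟩ := IsIntegrallyClosed.exists_algebraMap_eq_of_isIntegral_pow
      (R := ℤ) (by norm_num : 0 < 2) hint
    exact ⟨m, by simpa using hm⟩
  have hdm : (d : ℤ) ∣ m := by
    have h2 : m ^ 2 = d * ((α.den : ℤ) ^ 2 - α.num ^ 2) := by
      rw [← hm] at hsq
      exact_mod_cast hsq
    have hdZ : Squarefree (d : ℤ) := Int.squarefree_natCast.mpr hd
    exact (hdZ.dvd_pow_iff_dvd two_ne_zero).mp ⟨_, h2⟩
  obtain ⟨B, rfl⟩ := hdm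
  have hB : (B : ℚ) = β * α.den := by
    apply mul_left_cancel₀ hd0
    rw [← mul_assoc, ← hm]
    push_cast
    ring
  refine ⟨α.num, B, α.den, ?_, by exact_mod_cast α.den_ne_zero, by exact_mod_cast hα, ?_, ?_⟩
  · rw [Int.isCoprime_iff_gcd_eq_one]
    simpa [Int.gcd] using α.reduced
  · rw [hB]
    push_cast
    field_simp
  · have h1 : (α.num : ℚ) = α * α.den := (Rat.mul_den_eq_num α).symm
    have : (α.num : ℚ) ^ 2 + d * (B : ℚ) ^ 2 = (α.den : ℚ) ^ 2 := by
      rw [h1, hB]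
      linear_combination (α.den : ℚ) ^ 2 * h
    exact_mod_cast this

/-- For squarefree `d`, some linear functional takes values at distance at least `1 / 3` from the
integers on any given finite set of rational points of `x² + d y² = 1`. -/
lemma exists_functional_rat_conic {ι : Type*} [Fintype ι] {d : ℕ} (hd : Squarefree d)
    (α β : ι → ℚ) (h : ∀ j, α j ^ 2 + d * β j ^ 2 = 1) :
    ∃ s t : ℝ, ∀ j, 1 / 3 ≤ intDist (s * α j + t * β j) := by
  choose A B C hcop hC0 hα hβ hABC using fun j => exists_int_of_rat_conic hd (h j)
  rcases eq_or_ne d 1 with rfl | hd1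
  · have hodd : ∀ j, ¬ (2 : ℤ) ∣ C j := by
      rintro j ⟨c, hc⟩
      have hA : ¬ (2 : ℤ) ∣ A j := fun hA => by
        have := (hcop j).isUnit_of_dvd' hA ⟨c, hc⟩
        rw [Int.isUnit_iff] at this
        omega
      obtain ⟨a, ha⟩ : ∃ a, A j = 2 * a + 1 := ⟨A j / 2, by omega⟩
      have h4 := hABC j
      rw [ha, hc] at h4
      push_cast at h4
      rcases Int.even_or_odd' (B j) with ⟨b, hb | hb⟩ <;> rw [hb] at h4 <;> ring_nf at h4 <;> omega
    have hsum : ∀ j, (2 : ℤ) ∣ (A j + B j) - C j := fun j => by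
      have h4 := hABC j
      rcases Int.even_or_odd' (A j) with ⟨a, ha | ha⟩ <;>
      rcases Int.even_or_odd' (B j) with ⟨b, hb | hb⟩ <;>
      rcases Int.even_or_odd' (C j) with ⟨c, hc | hc⟩ <;>
      rw [ha, hb, hc] at h4 ⊢ <;> push_cast at h4 <;> ring_nf at h4 <;> omega
    obtain ⟨s, hs⟩ := exists_scaling_of_congr Nat.prime_two (fun j => A j + B j) C
      (by exact_mod_cast hodd) (fun j => Or.inl (by exact_mod_cast hsum j))
    refine ⟨s, s, fun j => ?_⟩
    convert hs j using 2
    rw [hα, hβ]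
    push_cast
    ring
  · obtain ⟨p, hp, hpd⟩ := Nat.exists_prime_and_dvd hd1
    have hpZ : Prime (p : ℤ) := Nat.prime_iff_prime_int.mp hp
    have hdvd : ∀ j, (p : ℤ) ∣ d * B j ^ 2 := fun j =>
      (Int.natCast_dvd_natCast.mpr hpd).mul_right _
    obtain ⟨s, hs⟩ := exists_scaling_of_congr hp A C
      (fun j hpC => by
        have hA2 : (p : ℤ) ∣ A j ^ 2 := by
          have : A j ^ 2 = C j ^ 2 - d * B j ^ 2 := by linarith [hABC j]
          rw [this]
          exact dvd_sub (dvd_pow hpC two_ne_zero) (hdvd j)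
        exact hpZ.not_isUnit ((hcop j).isUnit_of_dvd' (hpZ.dvd_of_dvd_pow hA2) hpC))
      (fun j => by
        apply hpZ.dvd_or_dvd
        have : (A j - C j) * (A j + C j) = -(d * B j ^ 2) := by linear_combination hABC j
        rw [this]
        exact (dvd_neg).mpr (hdvd j))
    refine ⟨s, 0, fun j => ?_⟩
    convert hs j using 2
    rw [hα]
    push_cast
    ring

lemma exists_squarefree_mul_sq_of_rat_pos {q : ℚ} (hq : 0 < q) :
    ∃ (d : ℕ) (r : ℚ), Squarefree d ∧ q = d * r ^ 2 := by
  obtain ⟨d, b, hdb, hsf⟩ := Nat.sq_mul_squarefree (q.num.toNat * q.den)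
  refine ⟨d, b / q.den, hsf, ?_⟩
  have hnum : ((q.num.toNat : ℕ) : ℚ) = q.num := by
    exact_mod_cast Int.toNat_of_nonneg (Rat.num_pos.mpr hq).le
  have hden : (q.den : ℚ) ≠ 0 := by exact_mod_cast q.den_ne_zero
  have h1 : (b : ℚ) ^ 2 * d = q.num * q.den := by
    rw [← hnum]
    exact_mod_cast hdb
  have h2 : q * q.den = q.num := Rat.mul_den_eq_num q
  rw [← h2] at h1
  field_simp
  linarith

lemma one_third_le_intDist_half_mul {c : ℝ} (hc : c ^ 2 = 1) : 1 / 3 ≤ intDist (c / 2) := by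
  apply one_third_le_intDist_of_sub_int 0 <;>
  rcases eq_or_eq_neg_of_sq_eq_sq c 1 (by rw [hc, one_pow]) with rfl | rfl <;> norm_num [abs_div]

/-- Points of the unit circle whose mutual cross products, and whose ordinates, are integral up to
a common factor admit a linear functional with values at distance at least `1 / 3` from the
integers. -/
lemma exists_functional_unit_vectors {ι : Type*} [Fintype ι] (a b : ι → ℝ) {Δ : ℝ} (hΔ : Δ ≠ 0)
    (hunit : ∀ j, a j ^ 2 + b j ^ 2 = 1) (hb : ∀ j, ∃ k : ℤ, b j * Δ = k)
    (hcross : ∀ i j, ∃ k : ℤ, (a i * b j - b i * a j) * Δ = k) :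
    ∃ s t : ℝ, ∀ j, 1 / 3 ≤ intDist (s * a j + t * b j) := by
  by_cases hall : ∀ j, b j = 0
  · refine ⟨1 / 2, 0, fun j => ?_⟩
    have := one_third_le_intDist_half_mul (c := a j) (by simpa [hall j] using hunit j)
    convert this using 2
    ring
  push Not at hall
  obtain ⟨i, hi⟩ := hall
  by_cases hpar : ∀ j, b j = 0 ∨ a i * b j - b i * a j = 0
  · refine ⟨1 / 2, (1 / 2 - a i / 2) / b i, fun j => ?_⟩
    rcases hpar j with hj | hj
    · have := one_third_le_intDist_half_mul (c := a j) (by simpa [hj] using hunit j)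
      convert this using 2
      rw [hj]
      ring
    · have haj : a j = b j / b i * a i := by
        field_simp
        linarith
      have hbj : b j = b j / b i * b i := by field_simp
      have := one_third_le_intDist_half_mul (c := b j / b i) (by
        have h1 := hunit j
        rw [haj] at h1
        nth_rewrite 2 [hbj] at h1
        linear_combination h1 - (b j / b i) ^ 2 * hunit i)
      convert this using 2
      rw [haj]
      field_simp
      ring
  push Not at hpar
  obtain ⟨l, hl, hil⟩ := hpar
  choose k hk using hb
  choose m hm using hcross i
  have hki : (k i : ℝ) ≠ 0 := by
    rw [← hk]
    exact mul_ne_zero hi hΔ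
  have hbj : ∀ j, b j = ((k j / k i : ℚ) : ℝ) * b i := fun j => by
    push_cast
    rw [← hk, ← hk]
    field_simp
  have haj : ∀ j, a j = ((k j / k i : ℚ) : ℝ) * a i + ((-(m j / k i) : ℚ) : ℝ) := fun j => by
    push_cast
    rw [← hk, ← hk, ← hm]
    field_simp
    ring
  obtain ⟨c, hc⟩ : ∃ c : ℚ, a i = c := by
    have h1 := hunit l
    rw [haj l, hbj l] at h1
    set x : ℚ := k l / k i with hx
    set y : ℚ := -(m l / k i) with hy
    have hx0 : (x : ℝ) ≠ 0 := fun h0 => hl (by rw [hbj l, h0, zero_mul])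
    have hy0 : (y : ℝ) ≠ 0 := fun h0 => hil (by
      rw [haj l, h0, hbj l]
      ring)
    refine ⟨(1 - x ^ 2 - y ^ 2) / (2 * x * y), ?_⟩
    push_cast
    rw [eq_div_iff (by positivity)]
    linear_combination h1 - (x : ℝ) ^ 2 * hunit i
  have hbi : b i ^ 2 = ((1 - c ^ 2 : ℚ) : ℝ) := by
    push_cast
    rw [← hc]
    linarith [hunit i]
  obtain ⟨d, r, hd, hdr⟩ := exists_squarefree_mul_sq_of_rat_pos (q := 1 - c ^ 2) (by
    have : 0 < b i ^ 2 := by positivity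
    rw [hbi] at this
    exact_mod_cast this)
  obtain ⟨s, t, hst⟩ := exists_functional_rat_conic hd
    (fun j => (k j / k i : ℚ) * c + -(m j / k i)) (fun j => (k j / k i) * r) (fun j => by
      have h1 := hunit j
      rw [haj j, hbj j, mul_pow, hbi, hc] at h1
      have h2 : ((k j / k i : ℚ) * c + -(m j / k i)) ^ 2 + (k j / k i : ℚ) ^ 2 * (1 - c ^ 2) = 1 := by
        exact_mod_cast h1
      rw [hdr] at h2
      linear_combination h2)
  refine ⟨s, t * r / b i, fun j => ?_⟩
  convert hst j using 2
  rw [haj j, hbj j, hc]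
  push_cast
  field_simp

lemma det_ne_zero_of_linearIndependent_pair {v w : ℝ × ℝ} (h : LinearIndependent ℝ ![v, w]) :
    v.1 * w.2 - v.2 * w.1 ≠ 0 := by
  intro h0
  rw [LinearIndependent.pair_iff] at h
  have h1 := h w.2 (-v.2) (by ext <;> simp <;> linarith)
  have h2 := h w.1 (-v.1) (by ext <;> simp <;> linarith)
  have h3 := h 1 0 (by
    ext
    · simp; linarith [h2.2]
    · simp; linarith [h1.2])
  exact one_ne_zero h3.1

/-- If `ε < 1/3` and the family of unit vectors `(cos θ j, sin θ j)` given by pairwise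
distinct angles is periodic, then the corresponding rotated strips of half-width `ε`
do not cover the plane. -/
theorem periodic_no_cover_below_one_third (ε : ℝ) (hε : ε < 1 / 3)
    (n : ℕ) (θ : Fin (n + 1) → ℝ) (hdist : Function.Injective θ)
    (hper : IsPeriodicFamily (fun j => (Real.cos (θ j), Real.sin (θ j)))) :
    ∃ x : ℝ × ℝ, ∀ j, ε < intDist (dot2 (Real.cos (θ j), Real.sin (θ j)) x) := by
  obtain ⟨v, w, hvw, hv, hw⟩ := hper
  choose A hA using hv
  choose B hB using hw
  simp only [dot2] at hA hB
  have hcross : ∀ i j, ∃ k : ℤ, Real.sin (θ j - θ i) * (v.1 * w.2 - v.2 * w.1) = k := fun i j => by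
    refine ⟨A i * B j - B i * A j, ?_⟩
    push_cast
    rw [← hA, ← hA, ← hB, ← hB, Real.sin_sub]
    ring
  obtain ⟨s, t, hst⟩ := exists_functional_unit_vectors
    (fun j => Real.cos (θ j - θ 0)) (fun j => Real.sin (θ j - θ 0))
    (det_ne_zero_of_linearIndependent_pair hvw) (fun j => Real.cos_sq_add_sin_sq _)
    (hcross 0) (fun i j => by
      obtain ⟨k, hk⟩ := hcross i j
      refine ⟨k, ?_⟩
      rw [← hk, show θ j - θ i = (θ j - θ 0) - (θ i - θ 0) by ring, Real.sin_sub (θ j - θ 0)]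
      ring)
  refine ⟨(s * Real.cos (θ 0) - t * Real.sin (θ 0), s * Real.sin (θ 0) + t * Real.cos (θ 0)),
    fun j => lt_of_lt_of_le hε (le_of_le_of_eq (hst j) (congrArg intDist ?_))⟩
  simp only [dot2, Real.cos_sub, Real.sin_sub]
  ring
end

section
/- Let (m_0, k_0, n_0), …, (m_N, k_N, n_N) be integer triples with n_j ≥ 1, m_j² + k_j² = n_j², and gcd(m_j, k_j, n_j) = 1 for every j, and let u_j = (m_j/n_j, k_j/n_j) ∈ ℝ² be the corresponding unit vectors. Then there exists a point x ∈ ℝ² such that ‖⟨u_j, x⟩‖ = 1/2 for every j = 0, …, N. In particular, these Pythagorean directions do not give a covering of the plane by strips of half-width ε for any ε < 1/2. -/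
/-- Every half-integer is at distance `1/2` from the nearest integer. -/
theorem intDist_int_add_half (a : ℤ) : intDist ((a : ℝ) + 1 / 2) = 1 / 2 := by
  have h : round ((a : ℝ) + 1 / 2) = a + 1 := by
    rw [round_eq, Int.floor_eq_iff]
    push_cast
    constructor <;> linarith
  rw [intDist, h]
  push_cast
  rw [show (a : ℝ) + 1 / 2 - (a + 1) = -(1 / 2) by ring, abs_neg]
  norm_num

/-- The hypotenuse of a primitive Pythagorean triple is odd. -/
theorem odd_hypotenuse {m k n : ℤ} (hpyth : m ^ 2 + k ^ 2 = n ^ 2)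
    (hgcd : Int.gcd (Int.gcd m k) n = 1) : Odd n := by
  by_contra hn
  rw [Int.not_odd_iff_even] at hn
  obtain ⟨c, rfl⟩ := hn
  have hmk : Even m ∧ Even k := by
    rcases Int.even_or_odd' m with ⟨a, rfl | rfl⟩ <;>
      rcases Int.even_or_odd' k with ⟨b, rfl | rfl⟩ <;> ring_nf at hpyth
    · exact ⟨even_two_mul a, even_two_mul b⟩
    all_goals omega
  have h : (2 : ℤ) ∣ Int.gcd (Int.gcd m k) (c + c) :=
    Int.dvd_coe_gcd (Int.dvd_coe_gcd hmk.1.two_dvd hmk.2.two_dvd) (Even.two_dvd ⟨c, rfl⟩)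
  rw [hgcd] at h
  norm_num at h

/-- The legs of a Pythagorean triple with odd hypotenuse have odd sum. -/
theorem odd_add_legs {m k n : ℤ} (hpyth : m ^ 2 + k ^ 2 = n ^ 2) (hn : Odd n) :
    Odd (m + k) := by
  have h : Odd (m ^ 2 + k ^ 2) := hpyth ▸ hn.pow
  simpa [Int.odd_add, Int.odd_pow, Int.even_pow] using h

/-- Given primitive Pythagorean triples `(m j, k j, n j)` with `n j ≥ 1`, there is a
point `x` of the plane at distance exactly `1/2` (mod 1) in every direction
`u j = (m j / n j, k j / n j)`; hence these directions give no covering for `ε < 1/2`. -/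
theorem pythagorean_no_cover (N : ℕ) (m k n : Fin (N + 1) → ℤ)
    (hn : ∀ j, 1 ≤ n j)
    (hpyth : ∀ j, (m j) ^ 2 + (k j) ^ 2 = (n j) ^ 2)
    (hgcd : ∀ j, Int.gcd (Int.gcd (m j) (k j)) (n j) = 1) :
    ∃ x : ℝ × ℝ, ∀ j,
      intDist (dot2 ((m j : ℝ) / (n j : ℝ), (k j : ℝ) / (n j : ℝ)) x) = 1 / 2 := by
  have hodd : ∀ j, Odd (n j) := fun j => odd_hypotenuse (hpyth j) (hgcd j)
  have hprod : Odd (∏ j, n j) :=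
    Finset.prod_induction n Odd (fun _ _ ha hb => ha.mul hb) odd_one fun j _ => hodd j
  refine ⟨(((∏ j, n j : ℤ) : ℝ) / 2, ((∏ j, n j : ℤ) : ℝ) / 2), fun j => ?_⟩
  obtain ⟨c, hc⟩ : n j ∣ ∏ j, n j := Finset.dvd_prod_of_mem n (Finset.mem_univ j)
  rw [hc] at hprod ⊢
  obtain ⟨a, ha⟩ := (odd_add_legs (hpyth j) (hodd j)).mul (Int.odd_mul.mp hprod).2
  have hn0 : (n j : ℝ) ≠ 0 := by exact_mod_cast (zero_lt_one.trans_le (hn j)).ne'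
  have haR : ((m j : ℝ) + k j) * c = 2 * a + 1 := by exact_mod_cast ha
  rw [← intDist_int_add_half a]
  congr 1
  simp only [dot2]
  push_cast
  field_simp
  linarith
end

section
/- Let D ≥ 2 be a squarefree integer, let (m_0, k_0, n_0), …, (m_N, k_N, n_N) be integer triples with n_j ≥ 1, m_j² + D·k_j² = n_j², and gcd(m_j, k_j, n_j) = 1 for every j, and let u_j = (m_j/n_j, k_j·√D/n_j) ∈ ℝ² be the corresponding unit vectors. Then there exists a point x ∈ ℝ² such that ‖⟨u_j, x⟩‖ ≥ 1/3 for every j = 0, …, N. In particular, these directions do not give a covering of the plane by strips of half-width ε for any ε < 1/3. -/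
theorem prime_not_dvd_of_primitive {D m k n p : ℤ} (hD : Squarefree D) (hp : Prime p)
    (hpD : p ∣ D) (heq : m ^ 2 + D * k ^ 2 = n ^ 2)
    (hgcd : Int.gcd (Int.gcd m k) n = 1) : ¬ p ∣ n := by
  intro hpn
  obtain ⟨E, rfl⟩ := hpD
  have hpm : p ∣ m := by
    refine hp.dvd_of_dvd_pow (n := 2) ?_
    obtain ⟨c, rfl⟩ := hpn
    exact ⟨p * c ^ 2 - E * k ^ 2, by linear_combination heq⟩
  have hpE : ¬ p ∣ E := by
    intro h
    exact hp.not_isUnit (hD p (mul_dvd_mul_left p h))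
  have hpk : p ∣ k := by
    refine hp.dvd_of_dvd_pow (n := 2) ((hp.dvd_or_dvd ?_).resolve_left hpE)
    obtain ⟨c, rfl⟩ := hpn
    obtain ⟨d, rfl⟩ := hpm
    refine ⟨c ^ 2 - d ^ 2, mul_left_cancel₀ hp.ne_zero ?_⟩
    linear_combination heq
  have h := Int.dvd_coe_gcd (Int.dvd_coe_gcd hpm hpk) hpn
  rw [hgcd] at h
  exact hp.not_isUnit (isUnit_of_dvd_one (by exact_mod_cast h))

theorem one_third_le_intDist_div {p w : ℤ} (hp : 2 ≤ p)
    (hw : p ∣ w - p / 2 ∨ p ∣ w + p / 2) : (1 : ℝ) / 3 ≤ intDist ((w : ℝ) / p) := by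
  have hp0 : (0 : ℝ) < p := by exact_mod_cast (by omega : 0 < p)
  unfold intDist
  generalize round ((w : ℝ) / p) = z
  have key : p ≤ 3 * |w - p * z| := by
    have aux : ∀ l : ℤ, p * l = 0 ∨ p ≤ p * l ∨ p * l ≤ -p := by
      intro l
      rcases lt_trichotomy l 0 with h | h | h
      · right; right; nlinarith
      · left; simp [h]
      · right; left; nlinarith
    rcases hw with ⟨l, hl⟩ | ⟨l, hl⟩
    all_goals
      have h := aux (l - z)
      rw [mul_sub] at h
      rcases abs_cases (w - p * z) with ⟨h₁, h₂⟩ | ⟨h₁, h₂⟩ <;> omega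
  have key' : (p : ℝ) ≤ 3 * |(w : ℝ) - p * z| := by exact_mod_cast key
  have e : (w : ℝ) / p - z = (w - p * z) / p := by field_simp
  rw [e, abs_div, abs_of_pos hp0, le_div_iff₀ hp0]
  linarith

/-- Let `D ≥ 2` be a squarefree integer and `(m j, k j, n j)` integer triples with
`n j ≥ 1`, `m j ^ 2 + D * k j ^ 2 = n j ^ 2` and `gcd (m j, k j, n j) = 1`. Then there
is a point `x` of the plane at distance at least `1/3` (mod 1) in every direction
`u j = (m j / n j, k j * √D / n j)`; hence no covering for `ε < 1/3`. -/
theorem quadratic_directions_no_cover (D : ℤ) (hD2 : 2 ≤ D) (hDsf : Squarefree D)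
    (N : ℕ) (m k n : Fin (N + 1) → ℤ)
    (hn : ∀ j, 1 ≤ n j)
    (heq : ∀ j, (m j) ^ 2 + D * (k j) ^ 2 = (n j) ^ 2)
    (hgcd : ∀ j, Int.gcd (Int.gcd (m j) (k j)) (n j) = 1) :
    ∃ x : ℝ × ℝ, ∀ j,
      (1 : ℝ) / 3 ≤
        intDist (dot2 ((m j : ℝ) / (n j : ℝ), (k j : ℝ) * Real.sqrt (D : ℝ) / (n j : ℝ)) x) := by
  obtain ⟨q, hq, hqD⟩ := Nat.exists_prime_and_dvd (n := D.natAbs) (by omega)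
  have hp : Prime (q : ℤ) := Nat.prime_iff_prime_int.mp hq
  have hpD : (q : ℤ) ∣ D := Int.natCast_dvd.mpr hqD
  have hp2 : (2 : ℤ) ≤ q := by exact_mod_cast hq.two_le
  generalize (q : ℤ) = p at hp hpD hp2
  have hpn : ∀ j, ¬ p ∣ n j := fun j =>
    prime_not_dvd_of_primitive hDsf hp hpD (heq j) (hgcd j)
  have hpL : ¬ p ∣ ∏ j, n j := by
    rw [hp.dvd_finsetProd_iff]
    rintro ⟨j, -, h⟩
    exact hpn j h
  obtain ⟨v, s, hs⟩ := (hp.coprime_iff_not_dvd).mpr hpL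
  refine ⟨(((p / 2 : ℤ) * s * ∏ j, n j : ℤ) / (p : ℝ), 0), fun j => ?_⟩
  obtain ⟨c, hc⟩ := Finset.dvd_prod_of_mem n (Finset.mem_univ j)
  rw [hc] at hs ⊢
  have hn0 : (n j : ℝ) ≠ 0 := by exact_mod_cast (by have := hn j; omega : n j ≠ 0)
  have hval : dot2 ((m j : ℝ) / (n j : ℝ), (k j : ℝ) * Real.sqrt (D : ℝ) / (n j : ℝ))
      (((p / 2 : ℤ) * s * (n j * c) : ℤ) / (p : ℝ), 0)
      = ((m j * (p / 2) * s * c : ℤ) : ℝ) / (p : ℝ) := by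
    generalize p / 2 = h
    simp only [dot2]
    push_cast
    field_simp
    ring
  rw [hval]
  refine one_third_le_intDist_div hp2 ?_
  generalize p / 2 = h
  obtain ⟨E, rfl⟩ := hpD
  have hmn : p ∣ (m j - n j) * (m j + n j) :=
    ⟨-(E * k j ^ 2), by linear_combination heq j⟩
  refine (hp.dvd_or_dvd hmn).imp ?_ ?_
  · rintro ⟨d, hd⟩
    exact ⟨d * h * s * c - h * v, by linear_combination h * s * c * hd + h * hs⟩
  · rintro ⟨d, hd⟩
    exact ⟨d * h * s * c + h * v, by linear_combination h * s * c * hd - h * hs⟩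
end

section
/- Let ε = 1/3 − 1/48 (= 5/16). Define nine angles as follows: θ_1 = 0, θ_2 = 2π/3, θ_3 = 4π/3; θ_4 is the angle with (cos θ_4, sin θ_4) = (1/3, √8/3), θ_5 = θ_4 + 2π/3, θ_6 = θ_4 + 4π/3; θ_7 is the angle with (cos θ_7, sin θ_7) = (1/3, −√8/3), θ_8 = θ_7 + 2π/3, θ_9 = θ_7 + 4π/3. Then the union ⋃_{j=1}^{9} R_{θ_j} E_ε equals ℝ²; equivalently, for every x ∈ ℝ² there exists some j ∈ {1, …, 9} with ‖⟨u_j, x⟩‖ ≤ 1/3 − 1/48, where u_j = (cos θ_j, sin θ_j). -/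
theorem exists_int_lt_of_lt_intDist {t ε : ℝ} (h : ε < intDist t) :
    ∃ n : ℤ, n + ε < t ∧ t < n + 1 - ε := by
  have key (m : ℤ) : ε < |t - m| := h.trans_le (round_le t m)
  have h₁ := key ⌊t⌋
  have h₂ := key (⌊t⌋ + 1)
  push_cast at h₂
  rw [abs_of_nonneg (by linarith [Int.floor_le t])] at h₁
  rw [abs_of_nonpos (by linarith [Int.lt_floor_add_one t])] at h₂
  exact ⟨⌊t⌋, by linarith, by linarith⟩

/-- If three reals sum to zero and are all at distance more than `5 / 16` from the integers, then
each of them is close to `1 / 3` or to `2 / 3` modulo one. -/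
theorem exists_int_near_third {x y z : ℝ} (hsum : x + y + z = 0) (hx : 5 / 16 < intDist x)
    (hy : 5 / 16 < intDist y) (hz : 5 / 16 < intDist z) :
    ∃ n : ℤ, (n + 5 / 16 < x ∧ x < n + 6 / 16) ∨ (n + 10 / 16 < x ∧ x < n + 11 / 16) := by
  obtain ⟨a, ha₁, ha₂⟩ := exists_int_lt_of_lt_intDist hx
  obtain ⟨b, hb₁, hb₂⟩ := exists_int_lt_of_lt_intDist hy
  obtain ⟨c, hc₁, hc₂⟩ := exists_int_lt_of_lt_intDist hz
  have h₁ : -3 < a + b + c := by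
    have : ((-3 : ℤ) : ℝ) < ((a + b + c : ℤ) : ℝ) := by push_cast; linarith
    exact_mod_cast this
  have h₂ : a + b + c < 0 := by
    have : ((a + b + c : ℤ) : ℝ) < ((0 : ℤ) : ℝ) := by push_cast; linarith
    exact_mod_cast this
  refine ⟨a, ?_⟩
  obtain h | h : a + b + c = -1 ∨ a + b + c = -2 := by omega
  · have h' : (a : ℝ) + b + c = -1 := by exact_mod_cast h
    exact Or.inl ⟨by linarith, by linarith⟩
  · have h' : (a : ℝ) + b + c = -2 := by exact_mod_cast h
    exact Or.inr ⟨by linarith, by linarith⟩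

theorem Real.cos_two_pi_div_three : Real.cos (2 * Real.pi / 3) = -1 / 2 := by
  rw [show 2 * Real.pi / 3 = Real.pi - Real.pi / 3 by ring, Real.cos_pi_sub, Real.cos_pi_div_three]
  ring

theorem Real.sum_cos_rotations (θ : ℝ) :
    Real.cos θ + Real.cos (θ + 2 * Real.pi / 3) + Real.cos (θ + 4 * Real.pi / 3) = 0 := by
  have h : Real.cos (θ + 4 * Real.pi / 3) = Real.cos (θ - 2 * Real.pi / 3) := by
    rw [← Real.cos_sub_two_pi]; congr 1; ring
  rw [h, Real.cos_add, Real.cos_sub, Real.cos_two_pi_div_three]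
  ring

theorem Real.sum_sin_rotations (θ : ℝ) :
    Real.sin θ + Real.sin (θ + 2 * Real.pi / 3) + Real.sin (θ + 4 * Real.pi / 3) = 0 := by
  have h : Real.sin (θ + 4 * Real.pi / 3) = Real.sin (θ - 2 * Real.pi / 3) := by
    rw [← Real.sin_sub_two_pi]; congr 1; ring
  rw [h, Real.sin_add, Real.sin_sub, Real.cos_two_pi_div_three]
  ring

theorem dot2_sum_rotations (θ : ℝ) (x : ℝ × ℝ) :
    dot2 (Real.cos θ, Real.sin θ) x
      + dot2 (Real.cos (θ + 2 * Real.pi / 3), Real.sin (θ + 2 * Real.pi / 3)) x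
      + dot2 (Real.cos (θ + 4 * Real.pi / 3), Real.sin (θ + 4 * Real.pi / 3)) x = 0 := by
  simp only [dot2]
  linear_combination x.1 * Real.sum_cos_rotations θ + x.2 * Real.sum_sin_rotations θ

/-- The nine strips of half-width `1/3 - 1/48` at the angles
`0, 2π/3, 4π/3, θ₄, θ₄ + 2π/3, θ₄ + 4π/3, θ₇, θ₇ + 2π/3, θ₇ + 4π/3`, where
`(cos θ₄, sin θ₄) = (1/3, √8/3)` and `(cos θ₇, sin θ₇) = (1/3, -√8/3)`, cover the
plane. -/
theorem pyjama_cover_below_one_third (θ₄ θ₇ : ℝ)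
    (h4c : Real.cos θ₄ = 1 / 3) (h4s : Real.sin θ₄ = Real.sqrt 8 / 3)
    (h7c : Real.cos θ₇ = 1 / 3) (h7s : Real.sin θ₇ = -(Real.sqrt 8) / 3) :
    ∀ x : ℝ × ℝ, ∃ j : Fin 9,
      intDist (dot2
        ((fun θ : ℝ => (Real.cos θ, Real.sin θ))
          (![0, 2 * Real.pi / 3, 4 * Real.pi / 3,
             θ₄, θ₄ + 2 * Real.pi / 3, θ₄ + 4 * Real.pi / 3,
             θ₇, θ₇ + 2 * Real.pi / 3, θ₇ + 4 * Real.pi / 3] j)) x)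
        ≤ 1 / 3 - 1 / 48 := by
  intro x
  by_contra! h
  have hε : (1 / 3 - 1 / 48 : ℝ) = 5 / 16 := by norm_num
  rw [hε] at h
  have hA := dot2_sum_rotations 0 x
  rw [zero_add, zero_add] at hA
  obtain ⟨a, ha⟩ := exists_int_near_third hA (h 0) (h 1) (h 2)
  obtain ⟨b, hb⟩ := exists_int_near_third (dot2_sum_rotations θ₄ x) (h 3) (h 4) (h 5)
  obtain ⟨c, hc⟩ := exists_int_near_third (dot2_sum_rotations θ₇ x) (h 6) (h 7) (h 8)
  simp only [dot2, Real.cos_zero, Real.sin_zero, h4c, h4s, h7c, h7s] at ha hb hc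
  have not_between (L : ℤ) (h₁ : (L : ℝ) < (2 * a - 3 * b - 3 * c : ℤ))
      (h₂ : ((2 * a - 3 * b - 3 * c : ℤ) : ℝ) < (L + 1 : ℤ)) : False := by
    have h₁' := Int.cast_lt.mp h₁
    have h₂' := Int.cast_lt.mp h₂
    omega
  rcases ha with ⟨ha₁, ha₂⟩ | ⟨ha₁, ha₂⟩ <;> rcases hb with ⟨hb₁, hb₂⟩ | ⟨hb₁, hb₂⟩ <;>
    rcases hc with ⟨hc₁, hc₂⟩ | ⟨hc₁, hc₂⟩ <;>
    first
    | exact not_between 0 (by push_cast; linarith) (by push_cast; linarith)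
    | exact not_between 1 (by push_cast; linarith) (by push_cast; linarith)
    | exact not_between 2 (by push_cast; linarith) (by push_cast; linarith)
    | exact not_between 3 (by push_cast; linarith) (by push_cast; linarith)
end

section
/- Let ε > 0 and suppose ε does not have the finite rotation property. Then there exists an additive group homomorphism γ : ℝ² → ℝ/ℤ which is not continuous and which satisfies |γ(u)| ≥ ε for every unit vector u ∈ ℝ², where |t| denotes the distance from t ∈ ℝ/ℤ to 0. -/
/-- `ε` has the finite rotation property if there are finitely many unit vectors
`u 0, …, u n` such that every point of the plane is within distance `ε` (mod 1)
of the lattice of strips in some direction `u j`. -/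
def HasFiniteRotationProperty (ε : ℝ) : Prop :=
  ∃ n : ℕ, ∃ u : Fin (n + 1) → ℝ × ℝ,
    (∀ j, (u j).1 ^ 2 + (u j).2 ^ 2 = 1) ∧
      ∀ x : ℝ × ℝ, ∃ j, intDist (dot2 (u j) x) ≤ ε

/-- The character `y ↦ ⟨y, x⟩ mod 1` of the plane. -/
def dotHom (x : ℝ × ℝ) : (ℝ × ℝ) →+ AddCircle (1 : ℝ) where
  toFun y := (dot2 y x : ℝ)
  map_zero' := by simp [dot2]
  map_add' y z := by
    rw [← AddCircle.coe_add]
    congr 1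
    simp only [dot2, Prod.fst_add, Prod.snd_add]
    ring

lemma norm_dotHom (x y : ℝ × ℝ) : ‖dotHom x y‖ = intDist (dot2 y x) :=
  UnitAddCircle.norm_eq

/-- Without the finite rotation property, any finite set of unit vectors is kept away from `0`
by some continuous character. -/
lemma exists_dotHom_of_not_frp {ε : ℝ} (h : ¬ HasFiniteRotationProperty ε)
    (s : Finset {u : ℝ × ℝ // u.1 ^ 2 + u.2 ^ 2 = 1}) :
    ∃ x : ℝ × ℝ, ∀ u ∈ s, ε ≤ ‖dotHom x u‖ := by
  by_contra! hs
  refine h ⟨s.card, Fin.cons (1, 0) fun i => ((s.equivFin.symm i).1 : ℝ × ℝ), fun j => ?_,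
    fun x => ?_⟩
  · refine Fin.cases (by simp) (fun i => ?_) j
    simpa using (s.equivFin.symm i).1.2
  · obtain ⟨u, hu, hux⟩ := hs x
    refine ⟨(s.equivFin ⟨u, hu⟩).succ, ?_⟩
    rw [norm_dotHom] at hux
    simpa using hux.le

/-- By compactness of the space of homomorphisms into the circle, some homomorphism keeps all
unit vectors away from `0`. -/
lemma exists_hom_of_not_frp {ε : ℝ} (h : ¬ HasFiniteRotationProperty ε) :
    ∃ γ : (ℝ × ℝ) →+ AddCircle (1 : ℝ),
      ∀ u : ℝ × ℝ, u.1 ^ 2 + u.2 ^ 2 = 1 → ε ≤ ‖γ u‖ := by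
  have : Fact ((0 : ℝ) < 1) := ⟨one_pos⟩
  have hcl : IsClosed (Set.range
      ((↑) : ((ℝ × ℝ) →+ AddCircle (1 : ℝ)) → (ℝ × ℝ) → AddCircle (1 : ℝ))) :=
    AddMonoidHom.isClosed_range_coe _ _
  obtain ⟨f, ⟨γ, rfl⟩, hf⟩ := hcl.isCompact.inter_iInter_nonempty
    (fun u : {u : ℝ × ℝ // u.1 ^ 2 + u.2 ^ 2 = 1} =>
      {f : (ℝ × ℝ) → AddCircle (1 : ℝ) | ε ≤ ‖f u‖})
    (fun u => isClosed_le continuous_const (continuous_apply _).norm)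
    (fun s => by
      obtain ⟨x, hx⟩ := exists_dotHom_of_not_frp h s
      exact ⟨dotHom x, ⟨_, rfl⟩, by simpa using hx⟩)
  exact ⟨γ, fun u hu => Set.mem_iInter.1 hf ⟨u, hu⟩⟩

/-- A continuous map from the line to the circle which avoids the antipode of `0` and takes
opposite values at two points vanishes somewhere. -/
lemma exists_eq_zero_of_eq_neg {f : ℝ → AddCircle (1 : ℝ)} (hf : Continuous f)
    (hlt : ∀ t, ‖f t‖ < 1 / 2) {a b : ℝ} (hab : f b = -f a) : ∃ t, f t = 0 := by
  have : Fact ((0 : ℝ) < 1) := ⟨one_pos⟩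
  let g : ℝ → ℝ := fun t => AddCircle.equivIco 1 (-(1 / 2) : ℝ) (f t)
  have hcoe : ∀ t, (g t : AddCircle (1 : ℝ)) = f t := fun t =>
    (AddCircle.equivIco 1 (-(1 / 2) : ℝ)).symm_apply_apply (f t)
  have hne : ∀ t, f t ≠ ((-(1 / 2) : ℝ) : AddCircle (1 : ℝ)) := fun t ht => by
    have h1 := hlt t
    rw [ht, AddCircle.coe_neg, norm_neg] at h1
    have h2 := AddCircle.norm_half_period_eq (1 : ℝ)
    linarith
  have hgc : Continuous g := continuous_iff_continuousAt.2 fun t =>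
    continuous_subtype_val.continuousAt.comp
      ((AddCircle.continuousAt_equivIco 1 (-(1 / 2) : ℝ) (hne t)).comp hf.continuousAt)
  have hmem : ∀ t, -(1 / 2) < g t ∧ g t < 1 / 2 := fun t => by
    have h1 := (AddCircle.equivIco 1 (-(1 / 2) : ℝ) (f t)).2
    refine ⟨lt_of_le_of_ne h1.1 fun he => hne t ?_, by linarith [h1.2]⟩
    rw [← hcoe t, he]
  have hsum : g b = -g a := by
    have h0 : ((g a + g b : ℝ) : AddCircle (1 : ℝ)) = 0 := by
      rw [AddCircle.coe_add, hcoe, hcoe, hab, add_neg_cancel]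
    obtain ⟨n, hn⟩ := (AddCircle.coe_eq_zero_iff 1).1 h0
    have hn' : (n : ℝ) = g a + g b := by simpa using hn
    have h1 := hmem a
    have h2 := hmem b
    have h3 : n < 1 := by exact_mod_cast (by linarith : (n : ℝ) < 1)
    have h4 : -1 < n := by exact_mod_cast (by linarith : (-1 : ℝ) < n)
    obtain rfl : n = 0 := by omega
    push_cast at hn'
    linarith
  obtain ⟨t, ht⟩ : ∃ t, g t = 0 := by
    rcases le_total (g a) 0 with h | h
    · exact mem_range_of_exists_le_of_exists_ge hgc ⟨a, h⟩ ⟨b, by linarith⟩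
    · exact mem_range_of_exists_le_of_exists_ge hgc ⟨b, by linarith⟩ ⟨a, h⟩
  exact ⟨t, by rw [← hcoe t, ht, AddCircle.coe_zero]⟩

/-- A continuous homomorphism from the plane to the circle kills some unit vector. -/
lemma exists_unit_map_eq_zero {γ : (ℝ × ℝ) →+ AddCircle (1 : ℝ)} (hγ : Continuous γ) :
    ∃ u : ℝ × ℝ, u.1 ^ 2 + u.2 ^ 2 = 1 ∧ γ u = 0 := by
  obtain ⟨δ, hδ, hball⟩ := Metric.continuousAt_iff.1 (hγ.continuousAt (x := 0)) (1 / 2)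
    (by norm_num)
  obtain ⟨n, hn⟩ := exists_nat_one_div_lt hδ
  set r : ℝ := 1 / ((n : ℝ) + 1) with hr
  have hr0 : 0 < r := by positivity
  have hsmall : ∀ t, ‖γ (r * Real.cos t, r * Real.sin t)‖ < 1 / 2 := fun t => by
    have hd : dist (r * Real.cos t, r * Real.sin t) (0 : ℝ × ℝ) < δ := by
      refine lt_of_le_of_lt ?_ hn
      rw [dist_zero_right, Prod.norm_def]
      simp only [Real.norm_eq_abs, abs_mul, abs_of_pos hr0]
      exact max_le (mul_le_of_le_one_right hr0.le (Real.abs_cos_le_one t))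
        (mul_le_of_le_one_right hr0.le (Real.abs_sin_le_one t))
    simpa using hball hd
  obtain ⟨t, ht⟩ := exists_eq_zero_of_eq_neg
    (f := fun t => γ (r * Real.cos t, r * Real.sin t)) (hγ.comp (by fun_prop)) hsmall
    (a := 0) (b := Real.pi) (by rw [← map_neg]; simp)
  refine ⟨(Real.cos t, Real.sin t), Real.cos_sq_add_sin_sq t, ?_⟩
  have hu : (Real.cos t, Real.sin t) = (n + 1) • (r * Real.cos t, r * Real.sin t) := by
    have hnr : ((n : ℝ) + 1) * r = 1 := by rw [hr]; field_simp
    ext <;> simp [← mul_assoc, hnr]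
  rw [hu, map_nsmul, ht, smul_zero]

/-- If `ε > 0` does not have the finite rotation property, then there is a
non-continuous additive homomorphism `γ : ℝ² → ℝ/ℤ` with `|γ(u)| ≥ ε` for every
unit vector `u`. -/
theorem exists_noncontinuous_hom_of_not_frp (ε : ℝ) (hε : 0 < ε)
    (h : ¬ HasFiniteRotationProperty ε) :
    ∃ γ : (ℝ × ℝ) →+ AddCircle (1 : ℝ), ¬ Continuous γ ∧
      ∀ u : ℝ × ℝ, u.1 ^ 2 + u.2 ^ 2 = 1 → ε ≤ ‖γ u‖ := by
  obtain ⟨γ, hγ⟩ := exists_hom_of_not_frp h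
  refine ⟨γ, fun hc => ?_, hγ⟩
  obtain ⟨u, hu, hu0⟩ := exists_unit_map_eq_zero hc
  have := hγ u hu
  rw [hu0, norm_zero] at this
  linarith
end

section
/- Let ε > 0 have the finite rotation property. Then there exists no additive group homomorphism γ : ℝ² → ℝ/ℤ such that |γ(u)| > ε for every unit vector u ∈ ℝ²; that is, for every additive homomorphism γ : ℝ² → ℝ/ℤ there exists a unit vector u ∈ ℝ² with |γ(u)| ≤ ε, where |t| denotes the distance from t ∈ ℝ/ℤ to 0. -/
open Finset
open scoped Pointwise

theorem card_nsmul_le_pow {G : Type*} [AddCommMonoid G] [DecidableEq G] (s : Finset G) (N : ℕ) :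
    #(N • s) ≤ (N + 1) ^ #s := by
  have hsub : N • s ⊆ (Fintype.piFinset fun _ : s ↦ range (N + 1)).image
      fun k ↦ ∑ i : s, k i • (i : G) := by
    induction N with
    | zero =>
      intro x hx
      simp only [zero_nsmul, Finset.mem_zero] at hx
      exact mem_image.2 ⟨fun _ ↦ 0, by simp, by simp [hx]⟩
    | succ N ih =>
      intro x hx
      rw [succ_nsmul] at hx
      obtain ⟨y, hy, g, hg, rfl⟩ := Finset.mem_add.1 hx
      obtain ⟨k, hk, rfl⟩ := mem_image.1 (ih hy)
      simp only [Fintype.mem_piFinset, mem_range] at hk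
      refine mem_image.2 ⟨k + Pi.single ⟨g, hg⟩ 1, ?_, ?_⟩
      · simp only [Fintype.mem_piFinset, mem_range, Pi.add_apply, Pi.single_apply]
        intro i
        have := hk i
        split_ifs <;> omega
      · simp [add_nsmul, sum_add_distrib, Pi.single_apply, ite_smul]
  calc #(N • s) ≤ _ := card_le_card hsub
    _ ≤ _ := card_image_le
    _ = (N + 1) ^ #s := by simp

theorem AddMonoidAlgebra.support_pow_subset {R G : Type*} [Semiring R] [AddCommMonoid G]
    [DecidableEq G] (f : AddMonoidAlgebra R G) (N : ℕ) :
    (f ^ N).coeff.support ⊆ N • f.coeff.support := by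
  induction N with
  | zero =>
    rw [pow_zero, zero_nsmul, AddMonoidAlgebra.one_def]
    exact Finsupp.support_single_subset
  | succ N ih =>
    rw [pow_succ, succ_nsmul]
    exact (AddMonoidAlgebra.support_coeff_mul_subset _ _).trans (Finset.add_subset_add_right ih)

theorem le_one_of_forall_pow_le_succ_pow {r : ℝ} (hr : 0 < r) (k : ℕ)
    (h : ∀ N : ℕ, r ^ N ≤ ((N : ℝ) + 1) ^ k) : r ≤ 1 := by
  by_contra! hlt
  have hlim := (tendsto_pow_const_mul_const_pow_of_abs_lt_one k
    (r := r⁻¹) (by rw [abs_of_pos (inv_pos.2 hr)]; exact inv_lt_one_of_one_lt₀ hlt)).const_mul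
      ((2 : ℝ) ^ k)
  rw [mul_zero] at hlim
  obtain ⟨N, hN, hN1⟩ := ((hlim.eventually_lt_const one_pos).and
    (Filter.eventually_ge_atTop 1)).exists
  have hN1' : (1 : ℝ) ≤ N := by exact_mod_cast hN1
  have h1 : r ^ N ≤ 2 ^ k * (N : ℝ) ^ k := by
    rw [← mul_pow]
    exact (h N).trans (pow_le_pow_left₀ (by positivity) (by linarith) k)
  rw [← mul_assoc, inv_pow, ← div_eq_mul_inv, div_lt_one (by positivity)] at hN
  linarith

section Pairing

variable {X G : Type*} [AddCommGroup X] [AddCommGroup G]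

theorem norm_coeff_le_of_forall_norm_sum_le (B : X →+ G →+ UnitAddCircle)
    (hB : ∀ g ≠ 0, ∃ x, B x g = ((1 / 2 : ℝ) : UnitAddCircle))
    (g₀ : G) (a : ℂ) (M : ℝ) (s : Finset G) (hs : g₀ ∉ s) (c : G → ℂ)
    (h : ∀ x, ‖a * (B x g₀).toCircle + ∑ g ∈ s, c g * (B x g).toCircle‖ ≤ M) : ‖a‖ ≤ M := by
  classical
  induction s using Finset.induction_on generalizing c with
  | empty => simpa using h 0
  | insert g s hg ih =>
    simp only [mem_insert, not_or] at hs
    obtain ⟨y, hy⟩ := hB (g - g₀) (sub_ne_zero.2 (Ne.symm hs.1))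
    have hhalf : ((AddCircle.toCircle ((1 / 2 : ℝ) : UnitAddCircle) : Circle) : ℂ) = -1 := by
      rw [AddCircle.toCircle_apply_mk, Circle.coe_exp]
      rw [← Complex.exp_pi_mul_I]
      congr 2
      push_cast
      ring
    refine ih hs.2 (fun i ↦ c i * (1 + (B y (i - g₀)).toCircle) / 2) fun x ↦ ?_
    set F : X → ℂ := fun x ↦ a * (B x g₀).toCircle + ∑ i ∈ insert g s, c i * (B x i).toCircle
    have hone : ((B y (-g₀)).toCircle : ℂ) * (B y g₀).toCircle = 1 := by
      rw [← Circle.coe_mul, ← AddCircle.toCircle_add, ← map_add]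
      simp
    have key : a * (B x g₀).toCircle
        + ∑ i ∈ s, c i * (1 + (B y (i - g₀)).toCircle) / 2 * (B x i).toCircle
        = (F x + (B y (-g₀)).toCircle * F (x + y)) / 2 := by
      have hsum : ∑ i ∈ s, c i * (1 + (B y (i - g₀)).toCircle) / 2 * (B x i).toCircle
          = ∑ i ∈ insert g s, c i * (1 + (B y (i - g₀)).toCircle) / 2 * (B x i).toCircle := by
        rw [sum_insert hg, hy, hhalf]
        simp
      rw [hsum]
      simp only [F, mul_add _ (a * _), mul_sum, map_add, AddMonoidHom.add_apply,
        AddCircle.toCircle_add, Circle.coe_mul, sub_eq_add_neg]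
      have : ∀ i, c i * (1 + ((B y i).toCircle : ℂ) * (B y (-g₀)).toCircle) / 2 * (B x i).toCircle
          = c i * (B x i).toCircle / 2
            + (B y (-g₀)).toCircle * (c i * ((B x i).toCircle * (B y i).toCircle)) / 2 := by
        intro i; ring
      simp only [this, sum_add_distrib, ← sum_div]
      linear_combination (-(a * (B x g₀).toCircle / 2)) * hone
    rw [key, norm_div, Complex.norm_two, div_le_iff₀ two_pos]
    calc _ ≤ ‖F x‖ + ‖((B y (-g₀)).toCircle : ℂ) * F (x + y)‖ := norm_add_le _ _
      _ ≤ M + M := by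
        rw [norm_mul, Circle.norm_coe, one_mul]
        exact add_le_add (h x) (h _)
      _ = M * 2 := by ring

/-- The evaluation of a trigonometric polynomial on `G` at a homomorphism `G → ℝ/ℤ`. -/
noncomputable def trigEval (γ : G →+ UnitAddCircle) : AddMonoidAlgebra ℂ G →ₐ[ℂ] ℂ :=
  AddMonoidAlgebra.lift ℂ ℂ G
    (Circle.coeHom.compAddChar (AddCircle.toCircle_addChar.compAddMonoidHom γ)).toMonoidHom

theorem trigEval_single (γ : G →+ UnitAddCircle) (g : G) (a : ℂ) :
    trigEval γ (.single g a) = a * (γ g).toCircle :=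
  AddMonoidAlgebra.lift_single _ _ _

theorem trigEval_apply (γ : G →+ UnitAddCircle) (f : AddMonoidAlgebra ℂ G) :
    trigEval γ f = ∑ g ∈ f.coeff.support, f.coeff g * (γ g).toCircle :=
  AddMonoidAlgebra.lift_apply _ _

theorem norm_coeff_le_of_forall_norm_trigEval_le (B : X →+ G →+ UnitAddCircle)
    (hB : ∀ g ≠ 0, ∃ x, B x g = ((1 / 2 : ℝ) : UnitAddCircle))
    (f : AddMonoidAlgebra ℂ G) {M : ℝ} (h : ∀ x, ‖trigEval (B x) f‖ ≤ M) (g : G) :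
    ‖f.coeff g‖ ≤ M := by
  classical
  by_cases hg : g ∈ f.coeff.support
  · refine norm_coeff_le_of_forall_norm_sum_le B hB g _ M (f.coeff.support.erase g)
      (notMem_erase _ _) f.coeff fun x ↦ ?_
    rw [add_sum_erase _ (fun i ↦ f.coeff i * ((B x i).toCircle : ℂ)) hg, ← trigEval_apply]
    exact h x
  · rw [Finsupp.notMem_support_iff.1 hg, norm_zero]
    exact (norm_nonneg _).trans (h 0)

/-- A form of Kronecker's approximation theorem: the values of a trigonometric polynomial at
arbitrary homomorphisms are controlled by its values at a separating family of homomorphisms. -/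
theorem norm_trigEval_le_of_forall (B : X →+ G →+ UnitAddCircle)
    (hB : ∀ g ≠ 0, ∃ x, B x g = ((1 / 2 : ℝ) : UnitAddCircle))
    (f : AddMonoidAlgebra ℂ G) {M : ℝ} (hM : 0 < M) (h : ∀ x, ‖trigEval (B x) f‖ ≤ M)
    (γ : G →+ UnitAddCircle) : ‖trigEval γ f‖ ≤ M := by
  classical
  rcases (norm_nonneg (trigEval γ f)).eq_or_lt with h0 | hpos
  · exact h0 ▸ hM.le
  rw [← div_le_one hM]
  refine le_one_of_forall_pow_le_succ_pow (by positivity) #f.coeff.support fun N ↦ ?_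
  rw [div_pow, div_le_iff₀ (by positivity), ← norm_pow, ← map_pow, trigEval_apply]
  have hcoeff := norm_coeff_le_of_forall_norm_trigEval_le B hB (f ^ N) (M := M ^ N) fun x ↦ by
    rw [map_pow, norm_pow]
    exact pow_le_pow_left₀ (norm_nonneg _) (h x) N
  calc _ ≤ ∑ g ∈ (f ^ N).coeff.support, M ^ N := norm_sum_le_of_le _ fun g _ ↦ by
        rw [norm_mul, Circle.norm_coe, mul_one]
        exact hcoeff g
    _ = #(f ^ N).coeff.support * M ^ N := by simp
    _ ≤ _ := by
      gcongr
      exact_mod_cast (card_le_card (f.support_pow_subset N)).trans (card_nsmul_le_pow _ N)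

end Pairing

theorem exists_forall_norm_one_add_toCircle_le {δ : ℝ} (hδ : 0 < δ) :
    ∃ m, 0 < m ∧ m < 2 ∧ ∀ t : UnitAddCircle, δ ≤ ‖t‖ → ‖(1 + t.toCircle : ℂ)‖ ≤ m := by
  have hcont : Continuous fun t : UnitAddCircle ↦ ‖(1 + t.toCircle : ℂ)‖ := by
    have := AddCircle.continuous_toCircle (T := 1)
    fun_prop
  have hK : IsCompact {t : UnitAddCircle | δ ≤ ‖t‖} :=
    (isClosed_le continuous_const continuous_norm).isCompact
  rcases Set.eq_empty_or_nonempty {t : UnitAddCircle | δ ≤ ‖t‖} with he | hne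
  · exact ⟨1, one_pos, one_lt_two, fun t ht ↦ absurd (show t ∈ {t : UnitAddCircle | δ ≤ ‖t‖} from ht)
      (by simp [he])⟩
  obtain ⟨t₀, ht₀, hmax⟩ := hK.exists_isMaxOn hne hcont.continuousOn
  refine ⟨_, lt_max_of_lt_left one_pos, max_lt one_lt_two ?_,
    fun t ht ↦ (hmax ht).trans (le_max_right 1 _)⟩
  have hne1 : (1 : ℂ) ≠ t₀.toCircle := by
    intro h
    have : t₀.toCircle = AddCircle.toCircle (0 : UnitAddCircle) := by
      rw [AddCircle.toCircle_zero]; exact Circle.ext h.symm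
    rw [AddCircle.injective_toCircle one_ne_zero this] at ht₀
    exact (norm_zero (E := UnitAddCircle) ▸ hδ.trans_le ht₀).false
  have hlt : ‖(1 + t₀.toCircle : ℂ)‖ < ‖(1 : ℂ)‖ + ‖(t₀.toCircle : ℂ)‖ :=
    norm_add_lt_of_not_sameRay fun h ↦ hne1 (h.eq_of_norm_eq (by rw [norm_one, Circle.norm_coe]))
  have h2 : ‖(1 : ℂ)‖ + ‖(t₀.toCircle : ℂ)‖ = 2 := by
    rw [norm_one, Circle.norm_coe, one_add_one_eq_two]
  exact h2 ▸ hlt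

/-- The homomorphism `g ↦ ⟨g, x⟩ mod 1` attached to `x`. -/
noncomputable def dotPairing : (ℝ × ℝ) →+ (ℝ × ℝ) →+ UnitAddCircle :=
  AddMonoidHom.mk' (fun x ↦ AddMonoidHom.mk' (fun g ↦ (dot2 g x : UnitAddCircle)) fun g h ↦ by
    rw [← AddCircle.coe_add]; congr 1; simp only [dot2, Prod.fst_add, Prod.snd_add]; ring)
    fun x y ↦ by
      ext g
      change ((dot2 g (x + y) : ℝ) : UnitAddCircle) = (dot2 g x : ℝ) + (dot2 g y : ℝ)
      rw [← AddCircle.coe_add]; congr 1; simp only [dot2, Prod.fst_add, Prod.snd_add]; ring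

theorem dotPairing_apply (x g : ℝ × ℝ) : dotPairing x g = (dot2 g x : UnitAddCircle) := rfl

theorem exists_dotPairing_eq_half {g : ℝ × ℝ} (hg : g ≠ 0) :
    ∃ x, dotPairing x g = ((1 / 2 : ℝ) : UnitAddCircle) := by
  have hpos : g.1 ^ 2 + g.2 ^ 2 ≠ 0 := by
    intro h
    refine hg (Prod.ext ?_ ?_) <;> simp only [Prod.fst_zero, Prod.snd_zero] <;> nlinarith
  refine ⟨(1 / (2 * (g.1 ^ 2 + g.2 ^ 2))) • g, ?_⟩
  rw [dotPairing_apply]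
  congr 1
  simp only [dot2, Prod.smul_fst, Prod.smul_snd, smul_eq_mul]
  field_simp

theorem norm_coe_eq_intDist (t : ℝ) : ‖(t : UnitAddCircle)‖ = intDist t :=
  UnitAddCircle.norm_eq

/-- If `ε > 0` has the finite rotation property, then every additive homomorphism
`γ : ℝ² → ℝ/ℤ` satisfies `|γ(u)| ≤ ε` for some unit vector `u`. -/
theorem exists_unit_small_of_frp (ε : ℝ) (hε : 0 < ε)
    (h : HasFiniteRotationProperty ε) :
    ∀ γ : (ℝ × ℝ) →+ AddCircle (1 : ℝ),
      ∃ u : ℝ × ℝ, u.1 ^ 2 + u.2 ^ 2 = 1 ∧ ‖γ u‖ ≤ ε := by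
  intro γ
  by_contra! hγ
  obtain ⟨n, u, hu, hx⟩ := h
  obtain ⟨j₀, hj₀⟩ := Finite.exists_min fun j ↦ ‖γ (u j)‖
  obtain ⟨m, hm0, hm2, hm⟩ := exists_forall_norm_one_add_toCircle_le
    (sub_pos.2 (hγ (u j₀) (hu j₀)))
  let f : AddMonoidAlgebra ℂ (ℝ × ℝ) :=
    1 + ∑ j, .single (u j) ((-γ (u j)).toCircle : ℂ)
  have heval : ∀ χ : (ℝ × ℝ) →+ UnitAddCircle,
      trigEval χ f = 1 + ∑ j, ((χ (u j) - γ (u j)).toCircle : ℂ) := by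
    intro χ
    simp only [f, map_add, map_one, map_sum, trigEval_single, sub_eq_add_neg,
      AddCircle.toCircle_add, Circle.coe_mul, mul_comm]
  have hsup : ∀ x, ‖trigEval (dotPairing x) f‖ ≤ m + n := by
    intro x
    obtain ⟨j, hj⟩ := hx x
    rw [heval, ← add_sum_erase univ _ (mem_univ j), ← add_assoc]
    refine (norm_add_le _ _).trans (add_le_add ?_ ?_)
    · refine hm _ ?_
      rw [← norm_coe_eq_intDist, ← dotPairing_apply] at hj
      have := norm_sub_norm_le (γ (u j)) (dotPairing x (u j))
      rw [norm_sub_rev] at this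
      linarith [hj₀ j]
    · refine (norm_sum_le_of_le _ fun i _ ↦ (Circle.norm_coe _).le).trans ?_
      simp
  have hγf := norm_trigEval_le_of_forall dotPairing (fun _ ↦ exists_dotPairing_eq_half) f
    (by positivity) hsup γ
  have hval : trigEval γ f = ((n + 2 : ℕ) : ℂ) := by
    rw [heval]
    simp only [sub_self, AddCircle.toCircle_zero, Circle.coe_one, sum_const, card_univ,
      Fintype.card_fin, nsmul_eq_mul, mul_one]
    push_cast
    ring
  rw [hval, Complex.norm_natCast] at hγf
  push_cast at hγf
  linarith
end

section
/- Let ε > 0 and let u_1, …, u_n ∈ ℝ² be unit vectors. Let M = {(m_1, …, m_n) ∈ ℤⁿ : m_1 u_1 + ⋯ + m_n u_n = 0}, let S = {(x_1, …, x_n) ∈ 𝕋ⁿ : m_1 x_1 + ⋯ + m_n x_n = 0 in 𝕋 for all (m_1, …, m_n) ∈ M}, where 𝕋 = ℝ/ℤ, and let X_ε = S ∩ (ε, 1−ε)ⁿ, where (ε, 1−ε)ⁿ ⊂ 𝕋ⁿ denotes the set of points all of whose coordinates have a representative in the open interval (ε, 1−ε). If the difference set X_ε − X_ε = {a − b : a,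 b ∈ X_ε} is not dense in S, then every ε' > ε has the finite rotation property (hence ε_0 ≤ ε, where ε_0 is the infimum of all ε with the finite rotation property). -/
open Pointwise

open Filter Topology

/-- The Fourier monomial with exponent `m` is the character `∑ j, m j • x j` of the torus. -/
theorem mFourier_apply_eq_toCircle_sum {ι : Type*} [Fintype ι] (m : ι → ℤ)
    (x : UnitAddTorus ι) :
    UnitAddTorus.mFourier m x = (AddCircle.toCircle (∑ j, m j • x j) : ℂ) := by
  have h : AddCircle.toCircle (∑ j, m j • x j) = ∏ j, AddCircle.toCircle (m j • x j) :=
    map_sum AddCircle.toCircle_addChar.toAddMonoidHom _ _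
  rw [h]
  exact (map_prod Circle.coeHom _ _).symm

/-- A closed subgroup of a finite-dimensional torus is the intersection of the kernels of the
characters that vanish on it. -/
theorem mem_of_forall_character_eq_zero {ι : Type*} [Fintype ι]
    (L : AddSubgroup (ι → AddCircle (1 : ℝ))) (hL : IsClosed (L : Set (ι → AddCircle (1 : ℝ))))
    (x : ι → AddCircle (1 : ℝ))
    (hx : ∀ m : ι → ℤ, (∀ l ∈ L, ∑ j, m j • l j = 0) → ∑ j, m j • x j = 0) : x ∈ L := by
  by_contra hxL
  have : CompactSpace L := isCompact_iff_compactSpace.mp hL.isCompact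
  let _ : MeasurableSpace L := borel L
  have : BorelSpace L := ⟨rfl⟩
  let μ : MeasureTheory.Measure L := MeasureTheory.Measure.addHaar
  have h_int : ∀ g : C(UnitAddTorus ι, ℂ), ∀ y : UnitAddTorus ι,
      MeasureTheory.Integrable (fun l : L => g (y + l)) μ := fun g y =>
    Continuous.integrable_of_hasCompactSupport (by fun_prop)
      (HasCompactSupport.of_compactSpace _)
  have key : ∀ p ∈ Submodule.span ℂ (Set.range (UnitAddTorus.mFourier (d := ι))),
      ∫ l : L, p (0 + l) ∂μ = ∫ l : L, p (x + l) ∂μ := by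
    intro p hp
    induction hp using Submodule.span_induction with
    | mem p hp =>
      obtain ⟨m, rfl⟩ := hp
      have hadd : ∀ a b : UnitAddTorus ι, UnitAddTorus.mFourier m (a + b) =
          UnitAddTorus.mFourier m a * UnitAddTorus.mFourier m b := by
        intro a b
        simp [mFourier_apply_eq_toCircle_sum, smul_add, Finset.sum_add_distrib,
          AddCircle.toCircle_add]
      by_cases hm : ∀ l ∈ L, ∑ j, m j • l j = 0
      · have h1 : UnitAddTorus.mFourier m x = 1 := by
          rw [mFourier_apply_eq_toCircle_sum, hx m hm]; simp
        simp [hadd, h1]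
      · push Not at hm
        obtain ⟨a, ha, hne⟩ := hm
        have hne' : UnitAddTorus.mFourier m a ≠ 1 := by
          rw [mFourier_apply_eq_toCircle_sum]
          intro h
          apply hne
          apply AddCircle.injective_toCircle one_ne_zero
          rw [AddCircle.toCircle_zero]
          exact Circle.ext (by simpa using h)
        have hz : ∫ l : L, UnitAddTorus.mFourier m (l : UnitAddTorus ι) ∂μ = 0 := by
          have h := MeasureTheory.integral_add_left_eq_self (μ := μ)
            (fun l : L => UnitAddTorus.mFourier m (l : UnitAddTorus ι)) ⟨a, ha⟩
          simp only [AddSubgroup.coe_add, hadd, MeasureTheory.integral_const_mul] at h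
          by_contra h0
          exact hne' (mul_right_cancel₀ h0 (by rw [h, one_mul]))
        simp [hadd, MeasureTheory.integral_const_mul, hz]
    | zero => simp
    | add p q _ _ ihp ihq =>
      simp only [ContinuousMap.add_apply]
      rw [MeasureTheory.integral_add (h_int p 0) (h_int q 0),
        MeasureTheory.integral_add (h_int p x) (h_int q x), ihp, ihq]
    | smul c p _ ih =>
      simp only [ContinuousMap.smul_apply, MeasureTheory.integral_smul, ih]
  have hclosed : IsClosed ((fun y : ι → AddCircle (1 : ℝ) => y - x) ⁻¹'
      (L : Set (ι → AddCircle (1 : ℝ)))) := hL.preimage (by fun_prop)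
  have hdisj : Disjoint (L : Set (ι → AddCircle (1 : ℝ)))
      ((fun y : ι → AddCircle (1 : ℝ) => y - x) ⁻¹' (L : Set (ι → AddCircle (1 : ℝ)))) := by
    rw [Set.disjoint_left]
    intro y hy hy'
    apply hxL
    have := L.sub_mem hy hy'
    simpa using this
  obtain ⟨f, hf0, hf1, -⟩ := exists_continuous_zero_one_of_isClosed hL hclosed hdisj
  let g : C(UnitAddTorus ι, ℂ) := ⟨fun y => (f y : ℂ), by fun_prop⟩
  have hg : g ∈ (Submodule.span ℂ
      (Set.range (UnitAddTorus.mFourier (d := ι)))).topologicalClosure := by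
    rw [UnitAddTorus.span_mFourier_closure_eq_top]; trivial
  obtain ⟨p, hp, hgp⟩ := Metric.mem_closure_iff.mp hg (1 / 3) (by norm_num)
  have hnear : ∀ y, ‖g y - p y‖ ≤ 1 / 3 := fun y => by
    rw [← dist_eq_norm]
    exact (ContinuousMap.dist_apply_le_dist y).trans hgp.le
  have hμ : 0 < μ.real Set.univ := MeasureTheory.measureReal_univ_pos
  have h0 : ‖∫ l : L, p (0 + l) ∂μ‖ ≤ 1 / 3 * μ.real Set.univ := by
    apply MeasureTheory.norm_integral_le_of_norm_le_const
    refine Eventually.of_forall fun l => ?_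
    have h := hnear (l : UnitAddTorus ι)
    have hgl : g (l : UnitAddTorus ι) = 0 := by
      simpa [g] using hf0 l.2
    rw [hgl, zero_sub, norm_neg] at h
    simpa using h
  have h1 : ‖∫ l : L, (1 - p (x + l)) ∂μ‖ ≤ 1 / 3 * μ.real Set.univ := by
    apply MeasureTheory.norm_integral_le_of_norm_le_const
    refine Eventually.of_forall fun l => ?_
    have h := hnear (x + l)
    have hgl : g (x + l) = 1 := by
      have := hf1 (x := x + l) (by simp)
      simpa [g] using this
    rwa [hgl] at h
  rw [MeasureTheory.integral_sub (MeasureTheory.integrable_const _) (h_int p x), ← key p hp] at h1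
  have h2 : ‖∫ _ : L, (1 : ℂ) ∂μ‖ = μ.real Set.univ := by simp
  have h3 := norm_sub_norm_le (∫ _ : L, (1 : ℂ) ∂μ) (∫ l : L, p (0 + l) ∂μ)
  rw [h2] at h3
  linarith

/-- A continuous homomorphism from the plane to the circle vanishes at some unit vector. -/
theorem exists_unit_eq_zero_of_continuous (f : ℂ →+ AddCircle (1 : ℝ)) (hf : Continuous f) :
    ∃ u : ℂ, ‖u‖ = 1 ∧ f u = 0 := by
  by_contra! hne
  let h : ℂ → ℝ := fun u => (AddCircle.equivIco 1 0 (f u) : ℝ)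
  have hcoe : ∀ u, ((h u : ℝ) : AddCircle (1 : ℝ)) = f u := fun u => AddCircle.coe_equivIco
  have hcont : ∀ u, ‖u‖ = 1 → ContinuousAt h u := by
    intro u hu
    have h1 := AddCircle.continuousAt_equivIco (1 : ℝ) 0 (x := f u) (by simpa using hne u hu)
    exact continuousAt_subtype_val.comp (h1.comp hf.continuousAt)
  have h_int : ∀ r : ℝ, (r : AddCircle (1 : ℝ)) = 0 → ∃ k : ℤ, (k : ℝ) = r := by
    intro r hr
    simpa using (AddCircle.coe_eq_zero_iff (1 : ℝ)).mp hr
  have hneg : ∀ u, ‖u‖ = 1 → h (-u) + h u = 1 := by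
    intro u hu
    have a := (AddCircle.equivIco 1 0 (f u)).2
    have b := (AddCircle.equivIco 1 0 (f (-u))).2
    have hpos : h u ≠ 0 := by
      intro h0
      apply hne u hu
      rw [← hcoe, h0]; simp
    obtain ⟨k, hk⟩ := h_int (h (-u) + h u) (by
      rw [AddCircle.coe_add, hcoe, hcoe]; simp)
    have a1 : 0 < h u := lt_of_le_of_ne a.1 hpos.symm
    have a2 : h u < 1 := by simpa only [zero_add] using a.2
    have b1 : 0 ≤ h (-u) := b.1
    have b2 : h (-u) < 1 := by simpa only [zero_add] using b.2
    have k1 : (0 : ℝ) < k := by linarith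
    have k2 : (k : ℝ) < 2 := by linarith
    have : k = 1 := by
      have : 0 < k := by exact_mod_cast k1
      have : k < 2 := by exact_mod_cast k2
      omega
    rw [← hk, this]; simp
  obtain ⟨ω, hω, hsum⟩ : ∃ ω : ℂ, ‖ω‖ = 1 ∧ 1 + ω + ω ^ 2 = 0 := by
    have hprim := Complex.isPrimitiveRoot_exp 3 (by norm_num)
    refine ⟨_, hprim.norm'_eq_one (by norm_num), ?_⟩
    have := hprim.geom_sum_eq_zero (by norm_num)
    simpa [Finset.sum_range_succ] using this
  let e : ℝ → ℂ := fun θ => Complex.exp (θ * Complex.I)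
  have he : ∀ θ, ‖e θ‖ = 1 := fun θ => Complex.norm_exp_ofReal_mul_I θ
  have hecont : Continuous e := by fun_prop
  have hc : ∀ w : ℂ, ‖w‖ = 1 → Continuous fun θ => h (e θ * w) := by
    intro w hw
    rw [continuous_iff_continuousAt]
    intro θ
    exact (hcont (e θ * w) (by simp [he, hw])).comp (f := fun θ => e θ * w)
      (by fun_prop)
  let G : ℝ → ℝ := fun θ => h (e θ * 1) + h (e θ * ω) + h (e θ * ω ^ 2)
  have hG : Continuous G := ((hc 1 (by simp)).add (hc ω hω)).add (hc _ (by simp [hω]))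
  have hGint : ∀ θ, ∃ k : ℤ, (k : ℝ) = G θ := by
    intro θ
    apply h_int
    simp only [G, AddCircle.coe_add, hcoe]
    rw [← map_add, ← map_add, ← mul_add, ← mul_add, hsum]
    simp
  have hGpi : G Real.pi + G 0 = 3 := by
    have e0 : e 0 = 1 := by simp [e]
    have e1 : e Real.pi = -1 := by simp [e]
    have h1 := hneg 1 (by simp)
    have h2 := hneg ω hω
    have h3 := hneg (ω ^ 2) (by simp [hω])
    simp only [G, e0, e1, neg_mul, one_mul]
    linarith
  obtain ⟨θ, hθ⟩ : (3 / 2 : ℝ) ∈ Set.range G := by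
    rcases le_total (G 0) (G Real.pi) with hle | hle
    · exact mem_range_of_exists_le_of_exists_ge hG ⟨0, by linarith⟩ ⟨Real.pi, by linarith⟩
    · exact mem_range_of_exists_le_of_exists_ge hG ⟨Real.pi, by linarith⟩ ⟨0, by linarith⟩
  obtain ⟨k, hk⟩ := hGint θ
  rw [hθ] at hk
  have : 2 * k = 3 := by
    have : (2 * k : ℝ) = 3 := by linarith
    exact_mod_cast this
  omega

/-- A complex number of norm at most `2` is a difference of two complex numbers of norm `1`. -/
theorem exists_unit_sub_unit_eq (z : ℂ) (hz : ‖z‖ ≤ 2) :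
    ∃ a b : ℂ, ‖a‖ = 1 ∧ ‖b‖ = 1 ∧ z = a - b := by
  set r : ℝ := ‖z‖ with hr
  have hr0 : 0 ≤ r := norm_nonneg z
  have hs : 0 ≤ 1 - (r / 2) ^ 2 := by nlinarith
  set s := Real.sqrt (1 - (r / 2) ^ 2) with hs'
  have hss : s ^ 2 = 1 - (r / 2) ^ 2 := Real.sq_sqrt hs
  have hnorm : ∀ t : ℝ, t ^ 2 = (r / 2) ^ 2 → ‖(⟨t, s⟩ : ℂ)‖ = 1 := by
    intro t ht
    rw [← sq_eq_sq₀ (norm_nonneg _) zero_le_one, Complex.sq_norm, Complex.normSq_apply]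
    simp only
    nlinarith
  have hd : (⟨r / 2, s⟩ : ℂ) - ⟨-(r / 2), s⟩ = (r : ℂ) := by
    apply Complex.ext <;> simp
  refine ⟨⟨r / 2, s⟩ * Complex.exp (z.arg * Complex.I),
    ⟨-(r / 2), s⟩ * Complex.exp (z.arg * Complex.I), ?_, ?_, ?_⟩
  · rw [norm_mul, hnorm _ rfl, Complex.norm_exp_ofReal_mul_I, one_mul]
  · rw [norm_mul, hnorm _ (by ring), Complex.norm_exp_ofReal_mul_I, one_mul]
  · rw [← sub_mul, hd, hr, Complex.norm_mul_exp_arg_mul_I]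

/-- If a homomorphism `f` from the plane to the circle has no zero among the unit vectors, then the
vectors `(f (z * u j))_j`, for `z` in the unit ball, are dense in the subgroup of the torus
cut out by the integer relations among the `u j`. -/
theorem mem_closure_image_ball {ι : Type*} [Fintype ι] (f : ℂ →+ AddCircle (1 : ℝ))
    (hf : ∀ u, ‖u‖ = 1 → f u ≠ 0) (u : ι → ℂ) (x : ι → AddCircle (1 : ℝ))
    (hx : ∀ m : ι → ℤ, ∑ j, m j • u j = 0 → ∑ j, m j • x j = 0) :
    x ∈ closure ((fun (z : ℂ) (j : ι) => f (z * u j)) '' Metric.ball 0 1) := by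
  let F : ℂ →+ (ι → AddCircle (1 : ℝ)) :=
    { toFun := fun z j => f (z * u j)
      map_zero' := by ext j; simp
      map_add' := fun a b => by ext j; simp [add_mul] }
  let L : AddSubgroup (ι → AddCircle (1 : ℝ)) :=
    { carrier := ⋂ δ : {δ : ℝ // 0 < δ}, closure (F '' Metric.ball 0 δ)
      zero_mem' := by
        simp only [Set.mem_iInter]
        intro δ
        exact subset_closure ⟨0, by simpa using δ.2, map_zero F⟩
      add_mem' := by
        intro a b ha hb
        simp only [Set.mem_iInter] at ha hb ⊢
        intro δ
        refine map_mem_closure₂ continuous_add (ha ⟨δ / 2, half_pos δ.2⟩)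
          (hb ⟨δ / 2, half_pos δ.2⟩) ?_
        rintro _ ⟨y, hy, rfl⟩ _ ⟨z, hz, rfl⟩
        refine ⟨y + z, ?_, map_add F y z⟩
        simp only [mem_ball_zero_iff] at hy hz ⊢
        linarith [norm_add_le y z]
      neg_mem' := by
        intro a ha
        simp only [Set.mem_iInter] at ha ⊢
        intro δ
        refine map_mem_closure continuous_neg (ha δ) ?_
        rintro _ ⟨y, hy, rfl⟩
        exact ⟨-y, by simpa using hy, map_neg F y⟩ }
  have hL : IsClosed (L : Set (ι → AddCircle (1 : ℝ))) :=
    isClosed_iInter fun _ => isClosed_closure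
  suffices hxL : x ∈ L from Set.mem_iInter.mp hxL ⟨1, one_pos⟩
  refine mem_of_forall_character_eq_zero L hL x fun m hm => hx m ?_
  by_contra hw
  set w := ∑ j, m j • u j with hw'
  have hF : ∀ z, ∑ j, m j • F z j = f (z * w) := by
    intro z
    rw [hw', Finset.mul_sum, map_sum]
    refine Finset.sum_congr rfl fun j _ => ?_
    rw [mul_smul_comm, map_zsmul]
    rfl
  have hlim : Tendsto (fun z => f (z * w)) (𝓝 0) (𝓝 0) := by
    rw [tendsto_iff_ultrafilter]
    intro G hG
    obtain ⟨l, -, hl⟩ := isCompact_univ.ultrafilter_le_nhds (G.map F) (by simp)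
    have hlF : Tendsto F G (𝓝 l) := hl
    have hlL : l ∈ L := by
      refine Set.mem_iInter.mpr fun δ => mem_closure_of_tendsto hlF ?_
      filter_upwards [hG (Metric.ball_mem_nhds 0 δ.2)] with z hz
      exact ⟨z, hz, rfl⟩
    have hχ : Continuous fun y : ι → AddCircle (1 : ℝ) => ∑ j, m j • y j := by fun_prop
    have := (hχ.tendsto l).comp hlF
    rw [hm l hlL] at this
    exact this.congr hF
  have hlim' : Tendsto f (𝓝 0) (𝓝 0) := by
    have hdiv : Tendsto (fun z : ℂ => z / w) (𝓝 0) (𝓝 0) := by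
      have : Continuous fun z : ℂ => z / w := by fun_prop
      simpa using this.tendsto 0
    refine (hlim.comp hdiv).congr fun z => ?_
    simp [hw]
  have hcont : Continuous f := continuous_of_continuousAt_zero f (by
    simpa [ContinuousAt] using hlim')
  obtain ⟨v, hv, hfv⟩ := exists_unit_eq_zero_of_continuous f hcont
  exact hf v hv hfv

theorem intDist_eq_norm (t : ℝ) : intDist t = ‖(t : AddCircle (1 : ℝ))‖ :=
  UnitAddCircle.norm_eq.symm

/-- If `ε` does not have the finite rotation property, a limit of the counterexamples is a
homomorphism from the plane to the circle that stays `ε`-away from `0` on unit vectors. -/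
theorem exists_hom_of_not_hasFiniteRotationProperty (ε : ℝ)
    (h : ¬ HasFiniteRotationProperty ε) :
    ∃ f : ℂ →+ AddCircle (1 : ℝ), ∀ u, ‖u‖ = 1 → ε ≤ ‖f u‖ := by
  classical
  have hfin : ∀ T : Finset ℂ, ∃ x : ℝ × ℝ, ∀ v ∈ T, ‖v‖ = 1 →
      ε < intDist (dot2 (v.re, v.im) x) := by
    intro T
    by_contra! hT
    apply h
    let T' : Finset ℂ := insert 1 (T.filter fun v => ‖v‖ = 1)
    obtain ⟨k, hk⟩ : ∃ k, T'.card = k + 1 :=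
      Nat.exists_eq_add_one_of_ne_zero (Finset.card_ne_zero_of_mem (Finset.mem_insert_self _ _))
    let e : T' ≃ Fin (k + 1) := T'.equivFinOfCardEq hk
    refine ⟨k, fun j => ((e.symm j : ℂ).re, (e.symm j : ℂ).im), fun j => ?_, fun x => ?_⟩
    · have hj : ‖(e.symm j : ℂ)‖ = 1 := by
        rcases Finset.mem_insert.mp (e.symm j).2 with hj | hj
        · rw [hj, norm_one]
        · exact (Finset.mem_filter.mp hj).2
      have := Complex.sq_norm (e.symm j : ℂ)
      rw [hj, Complex.normSq_apply] at this
      simp only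
      linarith
    · obtain ⟨v, hv, hv1, hle⟩ := hT x
      have hvT : v ∈ T' := Finset.mem_insert_of_mem (Finset.mem_filter.mpr ⟨hv, hv1⟩)
      exact ⟨e ⟨v, hvT⟩, by simpa using hle⟩
  choose x hx using hfin
  let U : Ultrafilter (Finset ℂ) := Ultrafilter.of atTop
  obtain ⟨f, -, hf⟩ := isCompact_univ.ultrafilter_le_nhds
    (U.map fun T (v : ℂ) => ((dot2 (v.re, v.im) (x T) : ℝ) : AddCircle (1 : ℝ))) (by simp)
  have hlim' : Tendsto (fun T (v : ℂ) => ((dot2 (v.re, v.im) (x T) : ℝ) : AddCircle (1 : ℝ)))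
      U (𝓝 f) := hf
  have hlim := tendsto_pi_nhds.mp hlim'
  have hadd : ∀ v w, f (v + w) = f v + f w := by
    intro v w
    refine tendsto_nhds_unique (hlim (v + w)) (((hlim v).add (hlim w)).congr fun T => ?_)
    rw [← AddCircle.coe_add]
    congr 1
    simp only [dot2, Complex.add_re, Complex.add_im]
    ring
  refine ⟨AddMonoidHom.mk' f hadd, fun v hv => ?_⟩
  refine ge_of_tendsto (hlim v).norm ?_
  have hev : ∀ᶠ T in (U : Filter (Finset ℂ)), ({v} : Finset ℂ) ≤ T :=
    (eventually_ge_atTop ({v} : Finset ℂ)).filter_mono (Ultrafilter.of_le atTop)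
  filter_upwards [hev] with T hT
  rw [← intDist_eq_norm]
  exact (hx T v (Finset.singleton_subset_iff.mp hT) hv).le

/-- A point of the circle at distance more than `ε` from `0` has a representative in `(ε, 1 - ε)`. -/
theorem exists_mem_Ioo_of_lt_norm (ε : ℝ) (y : AddCircle (1 : ℝ)) (hy : ε < ‖y‖) :
    ∃ r : ℝ, r ∈ Set.Ioo ε (1 - ε) ∧ y = (r : AddCircle (1 : ℝ)) := by
  have hr := (AddCircle.equivIco 1 0 y).2
  have hcoe : ((AddCircle.equivIco 1 0 y : ℝ) : AddCircle (1 : ℝ)) = y := AddCircle.coe_equivIco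
  set r : ℝ := (AddCircle.equivIco 1 0 y : ℝ)
  have hr0 : 0 ≤ r := hr.1
  have hr1 : r < 1 := by simpa only [zero_add] using hr.2
  rw [← hcoe, UnitAddCircle.norm_eq] at hy
  have h0 := round_le r 0
  have h1 := round_le r 1
  rw [Int.cast_zero, sub_zero, abs_of_nonneg hr0] at h0
  rw [Int.cast_one, abs_sub_comm r 1, abs_of_pos (sub_pos.mpr hr1)] at h1
  exact ⟨r, ⟨by linarith, by linarith⟩, hcoe.symm⟩

/-- Let `u 1, …, u n` be unit vectors in ℝ², `S ⊆ 𝕋ⁿ` the closed subgroup cut out by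
the integer linear relations among the `u j`, and `X_ε = S ∩ (ε, 1-ε)ⁿ`. If the
difference set `X_ε - X_ε` is not dense in `S`, then every `ε' > ε` has the finite
rotation property. -/
theorem frp_of_difference_set_not_dense (ε : ℝ) (hε : 0 < ε)
    (n : ℕ) (u : Fin n → ℝ × ℝ)
    (hunit : ∀ j, (u j).1 ^ 2 + (u j).2 ^ 2 = 1)
    (S : Set (Fin n → AddCircle (1 : ℝ)))
    (hS : S = {x | ∀ m : Fin n → ℤ, (∑ j, m j • u j = 0) → ∑ j, m j • x j = 0})
    (X : Set (Fin n → AddCircle (1 : ℝ)))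
    (hX : X = S ∩ {x | ∀ j, ∃ r : ℝ, r ∈ Set.Ioo ε (1 - ε) ∧ x j = (r : AddCircle (1 : ℝ))})
    (hnd : ¬ S ⊆ closure (X - X)) :
    ∀ ε' : ℝ, ε < ε' → HasFiniteRotationProperty ε' := by
  intro ε' hε'
  by_contra hfrp
  obtain ⟨f, hf⟩ := exists_hom_of_not_hasFiniteRotationProperty ε' hfrp
  let v : Fin n → ℂ := fun j => Complex.equivRealProdAddHom.symm (u j)
  have hv : ∀ j, ‖v j‖ = 1 := by
    intro j
    rw [← sq_eq_sq₀ (norm_nonneg _) zero_le_one, Complex.sq_norm, Complex.normSq_apply, one_pow,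
      ← hunit j, sq, sq]
    rfl
  have hrel : ∀ m : Fin n → ℤ, ∑ j, m j • v j = 0 ↔ ∑ j, m j • u j = 0 := by
    intro m
    rw [← map_eq_zero_iff _ Complex.equivRealProdAddHom.symm.injective, map_sum]
    simp only [map_zsmul, v]
  have hmem : ∀ a : ℂ, ‖a‖ = 1 → (fun j => f (a * v j)) ∈ X := by
    intro a ha
    subst hX hS
    refine ⟨fun m hm => ?_, fun j => ?_⟩
    · have := congrArg f (congrArg (a * ·) ((hrel m).mpr hm))
      simpa only [Finset.mul_sum, map_sum, mul_smul_comm, map_zsmul, mul_zero, map_zero]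
        using this
    · exact exists_mem_Ioo_of_lt_norm ε _ (hε'.trans_le (hf _ (by simp [ha, hv])))
  apply hnd
  intro x hx
  have hcl := mem_closure_image_ball f (fun w hw h0 => by
    have := hf w hw
    rw [h0, norm_zero] at this
    linarith) v x (fun m hm => by
      rw [hS] at hx
      exact hx m ((hrel m).mp hm))
  refine closure_mono ?_ hcl
  rintro _ ⟨z, hz, rfl⟩
  obtain ⟨a, b, ha, hb, rfl⟩ := exists_unit_sub_unit_eq z (by
    rw [mem_ball_zero_iff] at hz
    linarith)
  refine ⟨_, hmem a ha, _, hmem b hb, ?_⟩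
  ext j
  simp [sub_mul]
end

section
/- Every ε > 1/4 has the finite rotation property; that is, for every ε > 1/4 there exist finitely many unit vectors u_0, …, u_n ∈ ℝ² such that for every x ∈ ℝ² there is an index j with ‖⟨u_j, x⟩‖ ≤ ε. (Equivalently, ε_0 ≤ 1/4, where ε_0 is the infimum of all ε with the finite rotation property.) -/
open Filter Topology

/-- The limits of values of `χ` along sequences tending to `0`. -/
def AddMonoidHom.seqLimitsAtZero {E A : Type*} [SeminormedAddCommGroup E]
    [SeminormedAddCommGroup A] (χ : E →+ A) : AddSubgroup A where
  carrier := {k | ∃ w : ℕ → E, Tendsto w atTop (𝓝 0) ∧ Tendsto (fun i ↦ χ (w i)) atTop (𝓝 k)}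
  zero_mem' := ⟨fun _ ↦ 0, tendsto_const_nhds, by simpa using tendsto_const_nhds⟩
  add_mem' := by
    rintro a b ⟨v, hv, hva⟩ ⟨w, hw, hwb⟩
    exact ⟨fun i ↦ v i + w i, by simpa using hv.add hw, by simpa using hva.add hwb⟩
  neg_mem' := by
    rintro a ⟨v, hv, hva⟩
    exact ⟨fun i ↦ -v i, by simpa using hv.neg, by simpa using hva.neg⟩

/-- Since the domain is divisible and the codomain compact, the group of limits is divisible. -/
theorem AddMonoidHom.exists_nsmul_eq_of_mem_seqLimitsAtZero {E : Type*} [NormedAddCommGroup E]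
    [NormedSpace ℝ E] (χ : E →+ UnitAddCircle) {n : ℕ} (hn : n ≠ 0) {k : UnitAddCircle}
    (hk : k ∈ χ.seqLimitsAtZero) : ∃ l ∈ χ.seqLimitsAtZero, n • l = k := by
  obtain ⟨w, hw, hwk⟩ := hk
  obtain ⟨l, φ, hφ, hl⟩ := CompactSpace.tendsto_subseq fun i ↦ χ ((n : ℝ)⁻¹ • w i)
  refine ⟨l, ⟨fun i ↦ (n : ℝ)⁻¹ • w (φ i), ?_, hl⟩, ?_⟩
  · simpa using (hw.comp hφ.tendsto_atTop).const_smul (n : ℝ)⁻¹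
  · refine tendsto_nhds_unique (hl.const_smul n) ((hwk.comp hφ.tendsto_atTop).congr fun i ↦ ?_)
    have hn' : (n : ℝ) ≠ 0 := by exact_mod_cast hn
    simp only [Function.comp_apply, ← map_nsmul]
    rw [← Nat.cast_smul_eq_nsmul ℝ, smul_inv_smul₀ hn']

/-- A character which stays away from `1/2` near the origin is continuous. -/
theorem AddMonoidHom.continuous_of_norm_le_of_lt_half {E : Type*} [NormedAddCommGroup E]
    [NormedSpace ℝ E] (χ : E →+ UnitAddCircle) {c : ℝ} (hc : c < 1 / 2)
    (h : ∀ᶠ w in 𝓝 0, ‖χ w‖ ≤ c) : Continuous χ := by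
  have hK : ∀ k ∈ χ.seqLimitsAtZero, ‖k‖ ≤ c := by
    rintro k ⟨w, hw, hwk⟩
    exact le_of_tendsto hwk.norm (hw.eventually h)
  have hdense : ¬ Dense (χ.seqLimitsAtZero : Set UnitAddCircle) := by
    intro hd
    have hcl : closure (χ.seqLimitsAtZero : Set UnitAddCircle) ⊆ {k | ‖k‖ ≤ c} :=
      closure_minimal hK (isClosed_le continuous_norm continuous_const)
    have hhalf : ‖((1 / 2 : ℝ) : UnitAddCircle)‖ ≤ c := hcl (hd _)
    have hnorm := AddCircle.norm_half_period_eq (p := (1 : ℝ))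
    rw [hnorm, abs_one] at hhalf
    linarith
  have hbot : ∀ k ∈ χ.seqLimitsAtZero, k = 0 := by
    rw [AddCircle.dense_addSubgroup_iff_ne_zmultiples] at hdense
    push Not at hdense
    obtain ⟨a, ha, hKa⟩ := hdense
    obtain ⟨b, hb, hba⟩ := χ.exists_nsmul_eq_of_mem_seqLimitsAtZero ha
      (hKa ▸ AddSubgroup.mem_zmultiples a)
    have ha0 : a = 0 := by
      rw [hKa] at hb
      obtain ⟨m, rfl⟩ := AddSubgroup.mem_zmultiples_iff.1 hb
      rw [← hba, smul_comm, addOrderOf_nsmul_eq_zero, smul_zero]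
    intro k hk
    simpa [hKa, ha0] using hk
  refine continuous_of_continuousAt_zero χ ?_
  rw [ContinuousAt, map_zero]
  refine tendsto_of_subseq_tendsto fun w hw ↦ ?_
  obtain ⟨l, φ, hφ, hl⟩ := CompactSpace.tendsto_subseq fun i ↦ χ (w i)
  refine ⟨φ, ?_⟩
  rwa [← hbot l ⟨_, hw.comp hφ.tendsto_atTop, hl⟩]

theorem UnitAddCircle.exists_coe_eq_norm_eq_abs (y : UnitAddCircle) :
    ∃ t : ℝ, (t : UnitAddCircle) = y ∧ ‖y‖ = |t| ∧ |t| ≤ 1 / 2 := by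
  obtain ⟨s, rfl⟩ := QuotientAddGroup.mk_surjective y
  have hs : ((s - round s : ℝ) : UnitAddCircle) = s := by
    rw [AddCircle.coe_sub, sub_eq_self, AddCircle.coe_eq_zero_iff]
    exact ⟨round s, by simp⟩
  exact ⟨s - round s, hs, UnitAddCircle.norm_eq, abs_sub_round s⟩

theorem UnitAddCircle.norm_add_le_of_le_norm {y z : UnitAddCircle} {ε : ℝ} (hy : ε ≤ ‖y‖)
    (hz : ε ≤ ‖z‖) : ‖y + z‖ ≤ 1 - 2 * ε := by
  have key : ∀ y : UnitAddCircle, ε ≤ ‖y‖ → ‖y - ((1 / 2 : ℝ) : UnitAddCircle)‖ ≤ 1 / 2 - ε := by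
    intro y hy
    obtain ⟨t, rfl, ht, ht'⟩ := y.exists_coe_eq_norm_eq_abs
    rw [ht] at hy
    have hbound : ∀ m : ℤ, ‖((t - 1 / 2 : ℝ) : UnitAddCircle)‖ ≤ |t - 1 / 2 - m| := by
      intro m
      rw [UnitAddCircle.norm_eq]
      exact round_le _ m
    rw [← AddCircle.coe_sub]
    rcases abs_cases t with ⟨h1, h2⟩ | ⟨h1, h2⟩
    · refine (hbound 0).trans (abs_le.2 ⟨?_, ?_⟩) <;> push_cast <;> linarith
    · refine (hbound (-1)).trans (abs_le.2 ⟨?_, ?_⟩) <;> push_cast <;> linarith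
  have hone : ((1 / 2 : ℝ) : UnitAddCircle) + ((1 / 2 : ℝ) : UnitAddCircle) = 0 := by
    rw [← AddCircle.coe_add, AddCircle.coe_eq_zero_iff]
    exact ⟨1, by norm_num⟩
  calc ‖y + z‖ = ‖(y - ((1 / 2 : ℝ) : UnitAddCircle)) + (z - ((1 / 2 : ℝ) : UnitAddCircle))‖ := by
        rw [sub_add_sub_comm, hone, sub_zero]
    _ ≤ (1 / 2 - ε) + (1 / 2 - ε) := norm_add_le_of_le (key y hy) (key z hz)
    _ = 1 - 2 * ε := by ring

theorem UnitAddCircle.norm_eq_zero_or_half_of_im_toCircle_eq_zero {y : UnitAddCircle}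
    (h : (AddCircle.toCircle y : ℂ).im = 0) : ‖y‖ = 0 ∨ ‖y‖ = 1 / 2 := by
  obtain ⟨t, rfl, ht, ht'⟩ := y.exists_coe_eq_norm_eq_abs
  rw [AddCircle.toCircle_apply_mk, Circle.coe_exp, Complex.exp_ofReal_mul_I_im,
    Real.sin_eq_zero_iff] at h
  obtain ⟨n, hn⟩ := h
  have hn' : (n : ℝ) = 2 * t := by
    have := Real.pi_ne_zero
    field_simp at hn
    linarith
  have habs : |(n : ℝ)| ≤ 1 := by
    rw [hn', abs_mul, abs_two]
    linarith
  have hn1 : |n| ≤ 1 := by exact_mod_cast habs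
  obtain ⟨hl, hu⟩ := abs_le.1 hn1
  rw [ht, show t = n / 2 by linarith]
  interval_cases n <;> norm_num [abs_of_pos, abs_of_neg]

theorem exists_unit_add_unit_eq {w : ℝ × ℝ} (hw : w.1 ^ 2 + w.2 ^ 2 ≤ 4) :
    ∃ u v : ℝ × ℝ, u.1 ^ 2 + u.2 ^ 2 = 1 ∧ v.1 ^ 2 + v.2 ^ 2 = 1 ∧ u + v = w := by
  obtain ⟨a, b⟩ := w
  dsimp only at hw
  rcases eq_or_ne (a ^ 2 + b ^ 2) 0 with h0 | h0
  · have ha : a = 0 := by nlinarith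
    have hb : b = 0 := by nlinarith
    exact ⟨(1, 0), (-1, 0), by simp, by simp, by simp [ha, hb]⟩
  · have hpos : 0 < a ^ 2 + b ^ 2 := lt_of_le_of_ne (by positivity) h0.symm
    obtain ⟨s, hs⟩ : ∃ s : ℝ, s ^ 2 * (a ^ 2 + b ^ 2) = 1 - (a ^ 2 + b ^ 2) / 4 := by
      refine ⟨√((1 - (a ^ 2 + b ^ 2) / 4) / (a ^ 2 + b ^ 2)), ?_⟩
      rw [Real.sq_sqrt (div_nonneg (by linarith) hpos.le), div_mul_cancel₀ _ h0]
    refine ⟨(a / 2 - s * b, b / 2 + s * a), (a / 2 + s * b, b / 2 - s * a), ?_, ?_, ?_⟩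
    · dsimp only
      linear_combination hs
    · dsimp only
      linear_combination hs
    · ext <;> simp

/-- No character of the plane, continuous or not, is uniformly further than `1/4` from `0` on the
unit circle. -/
theorem exists_unit_norm_lt {ε : ℝ} (hε : 1 / 4 < ε) (χ : ℝ × ℝ →+ UnitAddCircle) :
    ∃ u : ℝ × ℝ, u.1 ^ 2 + u.2 ^ 2 = 1 ∧ ‖χ u‖ < ε := by
  by_contra! hχ
  have hsmall : ∀ w : ℝ × ℝ, w.1 ^ 2 + w.2 ^ 2 ≤ 4 → ‖χ w‖ ≤ 1 - 2 * ε := by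
    intro w hw
    obtain ⟨u, v, hu, hv, rfl⟩ := exists_unit_add_unit_eq hw
    rw [map_add]
    exact UnitAddCircle.norm_add_le_of_le_norm (hχ u hu) (hχ v hv)
  have hcont : Continuous χ := by
    refine χ.continuous_of_norm_le_of_lt_half (c := 1 - 2 * ε) (by linarith) ?_
    have hq : Continuous fun w : ℝ × ℝ ↦ w.1 ^ 2 + w.2 ^ 2 := by fun_prop
    exact (hq.tendsto' 0 0 (by simp) |>.eventually_le_const (by norm_num : (0 : ℝ) < 4)).mono hsmall
  let f : ℝ → ℝ := fun θ ↦ (AddCircle.toCircle (χ (Real.cos θ, Real.sin θ)) : ℂ).im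
  have hf : Continuous f := Complex.continuous_im.comp <| continuous_subtype_val.comp <|
    AddCircle.continuous_toCircle.comp <| hcont.comp <|
      Real.continuous_cos.prodMk Real.continuous_sin
  have hanti : f Real.pi = -f 0 := by
    have hneg : ((Real.cos Real.pi, Real.sin Real.pi) : ℝ × ℝ) = -(Real.cos 0, Real.sin 0) := by
      simp
    simp only [f]
    rw [hneg, map_neg, AddCircle.toCircle_neg, Circle.coe_inv_eq_conj, Complex.conj_im]
  obtain ⟨θ, -, hθ⟩ : (0 : ℝ) ∈ f '' Set.uIcc 0 Real.pi := by
    refine intermediate_value_uIcc hf.continuousOn ?_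
    rw [hanti, Set.mem_uIcc]
    rcases le_total (f 0) 0 with h | h
    · exact Or.inl ⟨h, by linarith⟩
    · exact Or.inr ⟨by linarith, h⟩
  have hunit := Real.cos_sq_add_sin_sq θ
  have hlow := hχ (Real.cos θ, Real.sin θ) hunit
  have hhigh := hsmall (Real.cos θ, Real.sin θ) (by dsimp only; linarith)
  rcases UnitAddCircle.norm_eq_zero_or_half_of_im_toCircle_eq_zero hθ with h | h <;> linarith

/-- Failure of the finite rotation property extends, by compactness, to a character bounded away
from `0` on the whole unit circle. -/
theorem exists_character_of_not_hasFiniteRotationProperty {ε : ℝ}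
    (h : ¬ HasFiniteRotationProperty ε) :
    ∃ χ : ℝ × ℝ →+ UnitAddCircle, ∀ u : ℝ × ℝ, u.1 ^ 2 + u.2 ^ 2 = 1 → ε ≤ ‖χ u‖ := by
  have hfin : ∀ F : Finset {u : ℝ × ℝ // u.1 ^ 2 + u.2 ^ 2 = 1},
      ∃ x : ℝ × ℝ, ∀ u ∈ F, ε < ‖(dot2 u x : UnitAddCircle)‖ := by
    intro F
    rcases F.eq_empty_or_nonempty with rfl | hF
    · exact ⟨0, by simp⟩
    obtain ⟨n, hn⟩ := Nat.exists_eq_succ_of_ne_zero hF.card_ne_zero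
    let e := F.equivFinOfCardEq hn
    unfold HasFiniteRotationProperty at h
    push Not at h
    obtain ⟨x, hx⟩ := h n (fun j ↦ (e.symm j : {u : ℝ × ℝ // u.1 ^ 2 + u.2 ^ 2 = 1}))
      fun j ↦ (e.symm j).1.2
    refine ⟨x, fun u hu ↦ ?_⟩
    rw [UnitAddCircle.norm_eq]
    simpa [intDist] using hx (e ⟨u, hu⟩)
  choose x hx using hfin
  let 𝒰 := Ultrafilter.of (atTop : Filter (Finset {u : ℝ × ℝ // u.1 ^ 2 + u.2 ^ 2 = 1}))
  have hlim : ∀ w : ℝ × ℝ, ∃ y : UnitAddCircle,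
      Tendsto (fun F ↦ (dot2 w (x F) : UnitAddCircle)) 𝒰 (𝓝 y) := fun w ↦
    ⟨_, (𝒰.map fun F ↦ (dot2 w (x F) : UnitAddCircle)).le_nhds_lim⟩
  choose g hg using hlim
  refine ⟨AddMonoidHom.mk' g fun v w ↦ ?_, fun u hu ↦ ?_⟩
  · refine tendsto_nhds_unique (hg (v + w)) (((hg v).add (hg w)).congr fun F ↦ ?_)
    rw [← AddCircle.coe_add]
    congr 1
    simp only [dot2, Prod.fst_add, Prod.snd_add]
    ring
  · refine ge_of_tendsto (hg u).norm (Ultrafilter.of_le _ ?_)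
    filter_upwards [eventually_ge_atTop {⟨u, hu⟩}] with F hF
    exact (hx F ⟨u, hu⟩ (hF (Finset.mem_singleton_self _))).le

/-- Every `ε > 1/4` has the finite rotation property. -/
theorem frp_above_one_fourth :
    ∀ ε : ℝ, 1 / 4 < ε → HasFiniteRotationProperty ε := by
  intro ε hε
  by_contra h
  obtain ⟨χ, hχ⟩ := exists_character_of_not_hasFiniteRotationProperty h
  obtain ⟨u, hu, hlt⟩ := exists_unit_norm_lt hε χ
  exact (hχ u hu).not_gt hlt
end

section
/- Let S = {(x_1, x_2, x_3) ∈ 𝕋³ : x_1 + x_2 + x_3 = 0 in 𝕋}, where 𝕋 = ℝ/ℤ, and for ε ∈ (0, 1/2) let X_ε = S ∩ (ε, 1−ε)³, where (ε, 1−ε)³ ⊂ 𝕋³ denotes the set of points all of whose coordinates have a representative in the open interval (ε, 1−ε). Then for every ε > 1/5, the difference set X_ε − X_ε = {a − b : a, b ∈ X_ε} is not dense in S. -/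
open Pointwise

/-- If the classes of `c` and `r` in `ℝ/ℤ` are at distance less than `δ`, then `c - r` is within
`δ` of an integer. -/
theorem exists_int_abs_sub_lt_of_dist_addCircle_lt {c r δ : ℝ}
    (h : dist (c : AddCircle (1 : ℝ)) (r : AddCircle (1 : ℝ)) < δ) :
    ∃ n : ℤ, |c - r - n| < δ := by
  rw [dist_eq_norm, ← AddCircle.coe_sub, AddCircle.norm_eq] at h
  exact ⟨round (c - r), by simpa using h⟩

/-- Reals whose classes in `ℝ/ℤ` add up to zero have an integer sum. -/
theorem exists_int_eq_of_addCircle_sum_eq_zero {r s t : ℝ}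
    (h : (r : AddCircle (1 : ℝ)) + s + t = 0) : ∃ n : ℤ, r + s + t = n := by
  rw [← AddCircle.coe_add, ← AddCircle.coe_add, AddCircle.coe_eq_zero_iff] at h
  obtain ⟨n, hn⟩ := h
  exact ⟨n, by simpa using hn.symm⟩

/-- Let `S = {(x₁, x₂, x₃) ∈ 𝕋³ : x₁ + x₂ + x₃ = 0}` and, for `ε ∈ (0, 1/2)`,
`X_ε = S ∩ (ε, 1-ε)³`. Then for every `ε > 1/5` the difference set `X_ε - X_ε`
is not dense in `S`. -/
theorem difference_set_not_dense_above_one_fifth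
    (S : Set (Fin 3 → AddCircle (1 : ℝ)))
    (hS : S = {x | x 0 + x 1 + x 2 = 0}) :
    ∀ ε : ℝ, 1 / 5 < ε → ε < 1 / 2 →
      ∀ X : Set (Fin 3 → AddCircle (1 : ℝ)),
        X = S ∩ {x | ∀ j, ∃ r : ℝ, r ∈ Set.Ioo ε (1 - ε) ∧ x j = (r : AddCircle (1 : ℝ))} →
        ¬ S ⊆ closure (X - X) := by
  intro ε hε _ X hX hdense
  subst hS hX
  -- The point `(3/5, 1/5, 1/5)` stays at distance at least `ε - 1/5` from the difference set.
  let c : Fin 3 → ℝ := ![3 / 5, 1 / 5, 1 / 5]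
  have hc : (fun j => (c j : AddCircle (1 : ℝ))) ∈
      {x : Fin 3 → AddCircle (1 : ℝ) | x 0 + x 1 + x 2 = 0} := by
    simp only [Set.mem_ofPred_eq]
    rw [← AddCircle.coe_add, ← AddCircle.coe_add, AddCircle.coe_eq_zero_iff]
    refine ⟨1, ?_⟩
    change (1 : ℤ) • (1 : ℝ) = 3 / 5 + 1 / 5 + 1 / 5
    norm_num
  obtain ⟨_, ⟨x, ⟨hx, hxr⟩, y, ⟨hy, hyr⟩, rfl⟩, hd⟩ :=
    Metric.mem_closure_iff.1 (hdense hc) (ε - 1 / 5) (by linarith)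
  choose a ha hxa using hxr
  choose b hb hyb using hyr
  simp only [Set.mem_ofPred_eq, hxa, hyb] at hx hy
  have hn : ∀ j, ∃ n : ℤ, |c j - (a j - b j) - n| < ε - 1 / 5 := fun j => by
    apply exists_int_abs_sub_lt_of_dist_addCircle_lt
    have := (dist_le_pi_dist _ _ j).trans_lt hd
    simpa only [Pi.sub_apply, hxa, hyb, ← AddCircle.coe_sub] using this
  choose n hn using hn
  obtain ⟨k, hk⟩ := exists_int_eq_of_addCircle_sum_eq_zero hx
  obtain ⟨l, hl⟩ := exists_int_eq_of_addCircle_sum_eq_zero hy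
  obtain ⟨ha0, ha0'⟩ := ha 0
  obtain ⟨ha1, ha1'⟩ := ha 1
  obtain ⟨ha2, ha2'⟩ := ha 2
  obtain ⟨hb0, hb0'⟩ := hb 0
  obtain ⟨hb1, hb1'⟩ := hb 1
  obtain ⟨hb2, hb2'⟩ := hb 2
  obtain ⟨h0, h0'⟩ := abs_lt.1 (hn 0)
  have hc0 : c 0 = 3 / 5 := rfl
  rw [hc0] at h0 h0'
  have hn0 : (1 : ℝ) ≤ n 0 := by
    have : (0 : ℝ) < n 0 := by linarith
    exact_mod_cast this
  have hl2 : (2 : ℝ) ≤ l := by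
    have : (1 : ℝ) < l := by linarith
    exact_mod_cast this
  have hk1 : (k : ℝ) ≤ 1 := by
    have : (k : ℝ) < 2 := by linarith
    have : k < 2 := by exact_mod_cast this
    exact_mod_cast Int.lt_add_one_iff.1 this
  -- On the other hand, the sums `k` and `l` differ by less than `1`.
  obtain ⟨h1, h1'⟩ := abs_lt.1 (hn 1)
  obtain ⟨h2, h2'⟩ := abs_lt.1 (hn 2)
  have hc1 : c 1 = 1 / 5 := rfl
  have hc2 : c 2 = 1 / 5 := rfl
  rw [hc1] at h1 h1'
  rw [hc2] at h2 h2'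
  have hn1 : (n 1 : ℝ) ≤ 0 := by
    have : (n 1 : ℝ) < 1 := by linarith
    have : n 1 < 1 := by exact_mod_cast this
    exact_mod_cast Int.lt_add_one_iff.1 this
  have hn2 : (n 2 : ℝ) ≤ 0 := by
    have : (n 2 : ℝ) < 1 := by linarith
    have : n 2 < 1 := by exact_mod_cast this
    exact_mod_cast Int.lt_add_one_iff.1 this
  have hn0' : (n 0 : ℝ) ≤ 1 := by
    have : (n 0 : ℝ) < 2 := by linarith
    have : n 0 < 2 := by exact_mod_cast this
    exact_mod_cast Int.lt_add_one_iff.1 this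
  linarith
end
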